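/- arXiv:2512.20001 — 5 statements merged into one kernel-verified Lean document; each statement's English description precedes it below -/
import Mathlib

section
/- For every n ≥ 2 there exist smin(n), smax(n) ∈ [0,1] with smin(n) ≤ smax(n), κ(n) ∈ [0,1], and τ(n) ≥ 0 such that the mechanism x_n defined by x_n(s,y) = 0 if s < smin(n), x_n(s,y) = κ(n)·1{∏_{k=1}^{n−1} y_k ≥ τ(n)·∏(1−y_k)} if smin(n) ≤ s < smax(n), and x_n(s,y) = 1 if s ≥ smax(n), is feasible in the n-agent model, and |V_n − V_n(x_n)| → 0 as n → ∞. -/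
open MeasureTheory Set Filter

noncomputable section

/-- The unit cube `[0,1]^m` inside `Fin m → ℝ`. -/
def cube (m : ℕ) : Set (Fin m → ℝ) := Set.univ.pi fun _ => Set.Icc (0:ℝ) 1

/-- `w⁺(y) = ∏ y_k · f(y_k)`. -/
def wplus (f : ℝ → ℝ) {m : ℕ} (y : Fin m → ℝ) : ℝ := ∏ k, y k * f (y k)

/-- `w⁻(y) = ∏ (1 - y_k) · f(y_k)`. -/
def wminus (f : ℝ → ℝ) {m : ℕ} (y : Fin m → ℝ) : ℝ := ∏ k, (1 - y k) * f (y k)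

/-- Hypotheses on the signal density `f` with derivative `f'` on `[L,R]`. -/
structure Density (f f' : ℝ → ℝ) (L R : ℝ) : Prop where
  nonneg : ∀ s, 0 ≤ f s
  zero_outside : ∀ s ∉ Set.Icc L R, f s = 0
  pos : ∀ s ∈ Set.Icc L R, 0 < f s
  hderiv : ∀ s ∈ Set.Icc L R, HasDerivWithinAt f (f' s) (Set.Icc L R) s
  cont_deriv : ContinuousOn f' (Set.Icc L R)
  total : (∫ s in L..R, f s) = 1
  mean : (∫ s in L..R, s * f s) = 1 / 2

/-- A mechanism is measurable with values in `[0,1]`. -/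
def IsMechanism {m : ℕ} (x : ℝ → (Fin m → ℝ) → ℝ) : Prop :=
  Measurable (Function.uncurry x) ∧ ∀ s y, x s y ∈ Set.Icc (0:ℝ) 1

/-- `A(t) = ∫_{[0,1]^m} x(t,y) w⁺(y) dy`. -/
def Amap (f : ℝ → ℝ) {m : ℕ} (x : ℝ → (Fin m → ℝ) → ℝ) (t : ℝ) : ℝ :=
  ∫ y in cube m, x t y * wplus f y

/-- `B(t) = ∫_{[0,1]^m} x(t,y) w⁻(y) dy`. -/
def Bmap (f : ℝ → ℝ) {m : ℕ} (x : ℝ → (Fin m → ℝ) → ℝ) (t : ℝ) : ℝ :=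
  ∫ y in cube m, x t y * wminus f y

/-- Interim payoff `U_x(t;s) = 2^m (s A(t) - (1-s) B(t))` (with `m = n-1`). -/
def Upay (f : ℝ → ℝ) {m : ℕ} (x : ℝ → (Fin m → ℝ) → ℝ) (t s : ℝ) : ℝ :=
  2 ^ m * (s * Amap f x t - (1 - s) * Bmap f x t)

/-- Feasibility: mechanism + participation + incentive compatibility on `[L,R]`. -/
def Feasible (f : ℝ → ℝ) (L R : ℝ) {m : ℕ} (x : ℝ → (Fin m → ℝ) → ℝ) : Prop :=
  IsMechanism x ∧ (∀ s ∈ Set.Icc L R, 0 ≤ Upay f x s s) ∧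
    (∀ s ∈ Set.Icc L R, ∀ t ∈ Set.Icc L R, Upay f x t s ≤ Upay f x s s)

/-- The designer's value `V(x)`. -/
def Value (f : ℝ → ℝ) (L R : ℝ) {m : ℕ} (x : ℝ → (Fin m → ℝ) → ℝ) : ℝ :=
  2 ^ m * ∫ s in L..R, (s * Amap f x s + (1 - s) * Bmap f x s) * f s

/-- The first-best utility `Ubar`. -/
def Ubar (f : ℝ → ℝ) (m : ℕ) (s : ℝ) : ℝ :=
  2 ^ m * ∫ y in cube m, max (s * wplus f y - (1 - s) * wminus f y) 0

set_option linter.unusedVariables false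
def KK (f : ℝ → ℝ) (s : ℝ) : ℝ := ∫ t in s..1, (2 * t - 1) * f t

def kk (f : ℝ → ℝ) (s : ℝ) : ℝ := 2 * s * (1 - s) * f s + KK f s

def GG (f : ℝ → ℝ) (q : ℝ) : ℝ :=
  2 * ((1 - q) * (∫ s in q..1, s * f s) + q * (∫ s in q..1, (1 - s) * f s))

section partA
variable {f f' : ℝ → ℝ} {L R : ℝ}

theorem Density.contOn (hf : Density f f' L R) : ContinuousOn f (Icc L R) :=
  fun s hs => (hf.hderiv s hs).continuousWithinAt

theorem Density.int (hf : Density f f' L R) {g : ℝ → ℝ} (hg : Continuous g) :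
    Integrable (fun s => g s * f s) := by
  have h : IntegrableOn (fun s => g s * f s) (Icc L R) :=
    (hg.continuousOn.mul hf.contOn).integrableOn_compact isCompact_Icc
  refine h.integrable_of_forall_notMem_eq_zero ?_
  intro s hs
  simp [hf.zero_outside s hs]

theorem Density.ii (hf : Density f f' L R) {g : ℝ → ℝ} (hg : Continuous g) (p q : ℝ) :
    IntervalIntegrable (fun s => g s * f s) volume p q := (hf.int hg).intervalIntegrable

theorem Density.full (hf : Density f f' L R) (hL : 0 ≤ L) (hLR : L < R) (hR : R ≤ 1)
    {p q : ℝ} (hp : p ≤ L) (hq : R ≤ q) (g : ℝ → ℝ) :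
    ∫ s in p..q, g s * f s = ∫ s in L..R, g s * f s := by
  rw [intervalIntegral.integral_of_le (by linarith), intervalIntegral.integral_of_le hLR.le,
    ← integral_Icc_eq_integral_Ioc, ← integral_Icc_eq_integral_Ioc]
  refine setIntegral_eq_of_subset_of_forall_sdiff_eq_zero measurableSet_Icc
    (Icc_subset_Icc hp hq) ?_
  intro s hs
  simp [hf.zero_outside s hs.2]

theorem Density.contAt (hf : Density f f' L R) {s : ℝ} (h1 : s ≠ L) (h2 : s ≠ R) :
    ContinuousAt f s := by
  by_cases h : s ∈ Icc L R
  · exact hf.contOn.continuousAt (Icc_mem_nhds (lt_of_le_of_ne h.1 (Ne.symm h1))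
      (lt_of_le_of_ne h.2 h2))
  · have : f =ᶠ[nhds s] fun _ => 0 := by
      filter_upwards [isClosed_Icc.isOpen_compl.mem_nhds h] with t ht
      exact hf.zero_outside t ht
    exact continuousAt_const.congr this.symm

theorem Density.tail_cont (hf : Density f f' L R) {g : ℝ → ℝ} (hg : Continuous g) :
    Continuous (fun q => ∫ s in q..1, g s * f s) := by
  have := intervalIntegral.continuous_primitive (μ := volume) (f := fun s => g s * f s)
    (fun p q => hf.ii hg p q) 1
  have h2 := this.neg
  refine h2.congr fun q => ?_
  exact (intervalIntegral.integral_symm (f := fun s => g s * f s) (μ := volume) 1 q).symm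

theorem Density.tail_deriv (hf : Density f f' L R) {g : ℝ → ℝ} (hg : Continuous g) {q : ℝ}
    (h1 : q ≠ L) (h2 : q ≠ R) :
    HasDerivAt (fun q => ∫ s in q..1, g s * f s) (-(g q * f q)) q := by
  exact intervalIntegral.integral_hasDerivAt_left (hf.ii hg q 1)
    ((hf.int hg).aestronglyMeasurable.stronglyMeasurableAtFilter)
    (hg.continuousAt.mul (hf.contAt h1 h2))

theorem Density.GG_cont (hf : Density f f' L R) : Continuous (GG f) := by
  unfold GG
  have h1 := hf.tail_cont (g := fun s => s) continuous_id
  have h2 := hf.tail_cont (g := fun s => 1 - s) (by fun_prop)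
  fun_prop

theorem Density.KK_cont (hf : Density f f' L R) : Continuous (KK f) :=
  hf.tail_cont (g := fun s => 2 * s - 1) (by fun_prop)

theorem Density.kk_ii (hf : Density f f' L R) (p q : ℝ) :
    IntervalIntegrable (kk f) volume p q := by
  unfold kk
  exact (hf.ii (g := fun s => 2 * s * (1 - s)) (by fun_prop) p q).add
    (hf.KK_cont.intervalIntegrable p q)

theorem Density.GG_eq (hf : Density f f' L R) (q : ℝ) :
    GG f q = 2 * ∫ s in q..1, kk f s := by
  have key := integral_eq_of_hasDerivAt_off_countable (a := q) (b := 1) (GG f)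
    (fun s => -2 * kk f s) (s := {L, R}) (by simp) hf.GG_cont.continuousOn ?_
    ((hf.kk_ii q 1).const_mul (-2))
  · have h1 : GG f 1 = 0 := by simp [GG]
    rw [h1, intervalIntegral.integral_const_mul] at key
    linarith
  · rintro x ⟨-, hx⟩
    simp only [mem_insert_iff, mem_singleton_iff, not_or] at hx
    have e1 := hf.tail_deriv (g := fun s => s) continuous_id hx.1 hx.2
    have e2 := hf.tail_deriv (g := fun s => 1 - s) (by fun_prop) hx.1 hx.2
    have e3 := ((((hasDerivAt_id x).const_sub 1).mul e1).add
      ((hasDerivAt_id x).mul e2)).const_mul 2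
    refine e3.congr_deriv ?_
    have : KK f x = (∫ s in x..1, s * f s) - ∫ s in x..1, (1 - s) * f s := by
      rw [← intervalIntegral.integral_sub (hf.ii (g := fun s => s) continuous_id x 1)
        (hf.ii (g := fun s => 1 - s) (by fun_prop) x 1)]
      unfold KK
      congr 1
      ext t
      ring
    simp only [kk, this, id]
    ring

theorem Density.KK_left (hf : Density f f' L R) (hL : 0 ≤ L) (hLR : L < R) (hR : R ≤ 1) {s : ℝ}
    (hs : s ≤ L) : KK f s = 0 := by
  unfold KK
  rw [hf.full hL hLR hR hs hR]
  have : ∀ t, (2 * t - 1) * f t = 2 * (t * f t) - f t := fun t => by ring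
  simp_rw [this]
  rw [intervalIntegral.integral_sub, intervalIntegral.integral_const_mul, hf.mean, hf.total]
  · norm_num
  · exact (hf.ii (g := fun s => s) continuous_id L R).const_mul 2
  · simpa using hf.ii (g := fun s => 1) continuous_const L R

theorem Density.KK_right (hf : Density f f' L R) (hR : R ≤ 1) {s : ℝ}
    (hs : R ≤ s) (hs1 : s ≤ 1) : KK f s = 0 := by
  unfold KK
  rw [intervalIntegral.integral_of_le hs1]
  refine setIntegral_eq_zero_of_forall_eq_zero fun t ht => ?_
  rw [hf.zero_outside t (fun h => absurd (lt_of_le_of_lt hs ht.1) (not_lt.2 h.2)), mul_zero]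

theorem bonnet {c k : ℝ → ℝ} (hc : Monotone c) (h0 : ∀ s, 0 ≤ c s) (h2 : ∀ s, c s ≤ 2)
    (hk : IntervalIntegrable k volume 0 1) {M : ℝ}
    (hM : ∀ q ∈ Icc (0:ℝ) 1, ∫ s in q..1, k s ≤ M) :
    ∫ s in (0:ℝ)..1, c s * k s ≤ 2 * M := by
  have hk' : IntegrableOn k (Ioc 0 1) := (intervalIntegrable_iff_integrableOn_Ioc_of_le zero_le_one).1 hk
  rw [intervalIntegral.integral_of_le zero_le_one]
  have e1 : ∀ s, c s * k s = ∫ r in Ioc (0:ℝ) 2, (if r < c s then k s else 0) := by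
    intro s
    have : (fun r => if r < c s then k s else 0) = (Iio (c s)).indicator (fun _ => k s) := by
      ext r; simp [indicator]
    rw [this, integral_indicator measurableSet_Iio, Measure.restrict_restrict measurableSet_Iio,
      setIntegral_const]
    have : (Iio (c s) ∩ Ioc (0:ℝ) 2 : Set ℝ) =ᵐ[volume] (Ioc 0 (c s) : Set ℝ) := by
      have h3 : Iio (c s) ∩ Ioc (0:ℝ) 2 = Ioo 0 (c s) := by
        ext r
        simp only [mem_inter_iff, mem_Iio, mem_Ioc, mem_Ioo]
        have := h2 s
        constructor
        · rintro ⟨a, b, c⟩; exact ⟨b, a⟩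
        · rintro ⟨a, b⟩; exact ⟨b, a, by linarith⟩
      rw [h3]; exact Ioo_ae_eq_Ioc
    rw [measureReal_congr this]
    simp [h0 s]
  simp_rw [e1]
  have hint : Integrable (Function.uncurry fun s r => if r < c s then k s else 0)
      ((volume.restrict (Ioc (0:ℝ) 1)).prod (volume.restrict (Ioc (0:ℝ) 2))) := by
    have h1 : Integrable (fun p : ℝ × ℝ => k p.1)
      ((volume.restrict (Ioc (0:ℝ) 1)).prod (volume.restrict (Ioc (0:ℝ) 2))) :=
      Integrable.comp_fst hk' _
    have hm : MeasurableSet {p : ℝ × ℝ | p.2 < c p.1} :=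
      measurableSet_lt measurable_snd (hc.measurable.comp measurable_fst)
    refine (h1.indicator hm).congr (Eventually.of_forall fun p => ?_)
    simp [indicator, Function.uncurry]
  rw [integral_integral_swap hint]
  have : (2 * M) = ∫ r in Ioc (0:ℝ) 2, M := by simp
  rw [this]
  refine integral_mono hint.integral_prod_right (integrable_const _) fun r => ?_
  change ∫ s in Ioc (0:ℝ) 1, (if r < c s then k s else 0) ≤ M
  set S := {s ∈ Ioc (0:ℝ) 1 | r < c s} with hS
  rcases S.eq_empty_or_nonempty with hE | hN
  · have : ∫ s in Ioc (0:ℝ) 1, (if r < c s then k s else 0) = 0 := by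
      refine setIntegral_eq_zero_of_forall_eq_zero fun t ht => ?_
      rw [if_neg]
      intro h
      have : t ∈ S := ⟨ht, h⟩
      simp [hE] at this
    rw [this]
    simpa using hM 1 (by simp)
  · have hB : BddBelow S := ⟨0, fun s hs => hs.1.1.le⟩
    have hq0 : 0 ≤ sInf S := le_csInf hN fun s hs => hs.1.1.le
    have hq1 : sInf S ≤ 1 := by
      obtain ⟨s, hs⟩ := hN
      exact (csInf_le hB hs).trans hs.1.2
    have := hM (sInf S) ⟨hq0, hq1⟩
    rw [intervalIntegral.integral_of_le hq1] at this
    refine le_of_eq_of_le ?_ this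
    have e : ∫ s in Ioc (0:ℝ) 1, (if r < c s then k s else 0)
        = ∫ s in Ioc (0:ℝ) 1, (Ioc (sInf S) 1).indicator k s := by
      refine setIntegral_congr_ae measurableSet_Ioc ?_
      have hne : ∀ᵐ s : ℝ, s ≠ sInf S := by simp [ae_iff]
      filter_upwards [hne] with s hs hs1
      by_cases h : r < c s
      · have : sInf S ≤ s := csInf_le hB ⟨hs1, h⟩
        rw [if_pos h, indicator_of_mem]
        exact ⟨lt_of_le_of_ne this (Ne.symm hs), hs1.2⟩
      · rw [if_neg h, indicator_of_notMem]
        intro h3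
        obtain ⟨t, ht, hts⟩ := exists_lt_of_csInf_lt hN h3.1
        exact h (ht.2.trans_le (hc hts.le))
    rw [e, setIntegral_indicator measurableSet_Ioc]
    congr 2
    ext t
    simp only [mem_inter_iff, mem_Ioc]
    constructor
    · rintro ⟨-, h⟩; exact h
    · intro h; exact ⟨⟨by linarith [h.1], h.2⟩, h⟩

/-- envelope theorem -/
theorem envelope {a b : ℝ} {u c : ℝ → ℝ} (h0 : ∀ s ∈ Icc a b, 0 ≤ c s)
    (h2 : ∀ s ∈ Icc a b, c s ≤ 2)
    (h : ∀ s ∈ Icc a b, ∀ t ∈ Icc a b, c s * (t - s) ≤ u t - u s) :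
    MonotoneOn c (Icc a b) ∧ ContinuousOn u (Icc a b) ∧
    ∃ S : Set ℝ, S.Countable ∧ ∀ x ∈ Ioo a b \ S, HasDerivAt u (c x) x := by
  have hm : MonotoneOn c (Icc a b) := by
    intro s hs t ht hst
    rcases hst.eq_or_lt with rfl | hlt
    · rfl
    have h1 := h s hs t ht
    have h3 := h t ht s hs
    by_contra hcon
    push Not at hcon
    nlinarith
  refine ⟨hm, ?_, _, hm.countable_not_continuousWithinAt, ?_⟩
  · have : LipschitzOnWith 2 u (Icc a b) := by
      refine LipschitzOnWith.of_dist_le_mul fun s hs t ht => ?_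
      have h1 := h s hs t ht
      have h3 := h t ht s hs
      rw [Real.dist_eq, Real.dist_eq]
      have a1 := h0 s hs
      have a2 := h0 t ht
      have a3 := h2 s hs
      have a4 := h2 t ht
      push_cast
      rcases le_total s t with hst | hst
      · rw [abs_of_nonpos (sub_nonpos.2 hst), abs_le]
        constructor <;> nlinarith
      · rw [abs_of_nonneg (sub_nonneg.2 hst), abs_le]
        constructor <;> nlinarith
    exact this.continuousOn
  · rintro x ⟨hx, hxS⟩
    have hxI : x ∈ Icc a b := Ioo_subset_Icc_self hx
    have hcx : ContinuousAt c x := by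
      have : ContinuousWithinAt c (Icc a b) x := by
        by_contra hcon
        exact hxS ⟨hxI, hcon⟩
      exact this.continuousAt (Icc_mem_nhds hx.1 hx.2)
    rw [hasDerivAt_iff_isLittleO, Asymptotics.isLittleO_iff]
    intro ε hε
    have hev : ∀ᶠ t in nhds x, |c t - c x| < ε := by
      have := Metric.tendsto_nhds.1 hcx ε hε
      simpa [Real.dist_eq] using this
    filter_upwards [hev, Icc_mem_nhds hx.1 hx.2] with t ht htI
    have h1 := h x hxI t htI
    have h3 := h t htI x hxI
    simp only [Real.norm_eq_abs, smul_eq_mul]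
    rw [abs_lt] at ht
    have p1 : 0 ≤ u t - u x - (t - x) * c x := by linarith
    rw [abs_of_nonneg p1]
    have p2 : u t - u x - (t - x) * c x ≤ (c t - c x) * (t - x) := by linarith
    refine p2.trans ((le_abs_self _).trans ?_)
    rw [abs_mul]
    gcongr
    exact (abs_lt.2 ht).le
end partA
section partB
variable {f f' : ℝ → ℝ} {L R : ℝ}

theorem support_line {G : ℝ → ℝ} (hG : Continuous G) {α : ℝ}
    (h : ∀ q1 ∈ Ico (0:ℝ) (1/2), ∀ q2 ∈ Ioc (1/2:ℝ) 1,
      (q2 - 1/2) * G q1 + (1/2 - q1) * G q2 ≤ α * (q2 - q1)) :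
    ∃ β, ∀ q ∈ Icc (0:ℝ) 1, G q ≤ α + β * (q - 1/2) := by
  have hdiv : ∀ q1 ∈ Ico (0:ℝ) (1/2), ∀ q2 ∈ Ioc (1/2:ℝ) 1,
      (G q2 - α) / (q2 - 1/2) ≤ (α - G q1) / (1/2 - q1) := by
    intro q1 h1 q2 h2
    have := h q1 h1 q2 h2
    rw [div_le_div_iff₀ (by linarith [h2.1]) (by linarith [h1.2])]
    nlinarith
  have hmid : G (1/2) ≤ α := by
    have ht : Tendsto (fun d : ℝ => (G (1/2 - d) + G (1/2 + d)) / 2) (nhdsWithin 0 (Ioi 0))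
        (nhds ((G (1/2 - 0) + G (1/2 + 0)) / 2)) := by
      have : Continuous (fun d : ℝ => (G (1/2 - d) + G (1/2 + d)) / 2) := by fun_prop
      exact (this.tendsto 0).mono_left nhdsWithin_le_nhds
    have := le_of_tendsto ht (b := α) (by
      filter_upwards [Ioo_mem_nhdsGT (show (0:ℝ) < 1/2 by norm_num)] with d hd
      have := h (1/2 - d) ⟨by linarith [hd.2], by linarith [hd.1]⟩ (1/2 + d)
        ⟨by linarith [hd.1], by linarith [hd.2]⟩
      have hd0 := hd.1
      have h4 : d * (G (1/2 - d) + G (1/2 + d)) ≤ d * (2 * α) := by linarith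
      have := le_of_mul_le_mul_left h4 hd0
      linarith)
    simp only [sub_zero, add_zero] at this
    linarith
  set T := (fun q => (G q - α) / (q - 1/2)) '' Ioc (1/2:ℝ) 1 with hT
  have hTn : T.Nonempty := ⟨_, 1, ⟨by norm_num, le_rfl⟩, rfl⟩
  have hTb : BddAbove T := by
    refine ⟨(α - G 0) / (1/2 - 0), ?_⟩
    rintro _ ⟨q, hq, rfl⟩
    exact hdiv 0 ⟨le_rfl, by norm_num⟩ q hq
  refine ⟨sSup T, fun q hq => ?_⟩
  rcases lt_trichotomy q (1/2) with hlt | heq | hgt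
  · have : sSup T ≤ (α - G q) / (1/2 - q) := by
      refine csSup_le hTn ?_
      rintro _ ⟨q2, hq2, rfl⟩
      exact hdiv q ⟨hq.1, hlt⟩ q2 hq2
    rw [le_div_iff₀ (by linarith)] at this
    linarith
  · subst heq; simpa using hmid
  · have : (G q - α) / (q - 1/2) ≤ sSup T := le_csSup hTb ⟨q, ⟨hgt, hq.2⟩, rfl⟩
    rw [div_le_iff₀ (by linarith)] at this
    linarith

theorem upper0 (hL : 0 ≤ L) (hLR : L < R) (hR : R ≤ 1) (hf : Density f f' L R) {a b : ℝ → ℝ}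
    (ha : ∀ s ∈ Icc L R, a s ∈ Icc (0:ℝ) 1) (hb : ∀ s ∈ Icc L R, b s ∈ Icc (0:ℝ) 1)
    (hu0 : ∀ s ∈ Icc L R, 0 ≤ s * a s - (1 - s) * b s)
    (hu1 : ∀ s ∈ Icc L R, 2 * s - 1 ≤ s * a s - (1 - s) * b s)
    (hIC : ∀ s ∈ Icc L R, ∀ t ∈ Icc L R, s * a t - (1 - s) * b t ≤ s * a s - (1 - s) * b s)
    {α : ℝ} (hα : ∀ q1 ∈ Ico (0:ℝ) (1/2), ∀ q2 ∈ Ioc (1/2:ℝ) 1,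
      (q2 - 1/2) * GG f q1 + (1/2 - q1) * GG f q2 ≤ α * (q2 - q1)) :
    IntervalIntegrable (fun s => (s * a s + (1 - s) * b s) * f s) volume L R ∧
    ∫ s in L..R, (s * a s + (1 - s) * b s) * f s ≤ α := by
  obtain ⟨β, hβ⟩ := support_line hf.GG_cont hα
  set u : ℝ → ℝ := fun s => s * a s - (1 - s) * b s with hu
  have hLm : L ∈ Icc L R := ⟨le_rfl, hLR.le⟩
  have hRm : R ∈ Icc L R := ⟨hLR.le, le_rfl⟩
  obtain ⟨hmono, hucont, S, hS, hder⟩ := envelope (a := L) (b := R) (u := u)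
    (c := fun s => a s + b s)
    (fun s hs => add_nonneg (ha s hs).1 (hb s hs).1)
    (fun s hs => by linarith [(ha s hs).2, (hb s hs).2])
    (fun s hs t ht => by have := hIC t ht s hs; simp only [hu]; linarith)
  -- the extension
  set c0 := u L / L with hc0
  set c1 := if R < 1 then (1 - u R) / (1 - R) else 2 with hc1
  have e0 : c0 * L = u L := by
    rcases hL.eq_or_lt with h | h
    · have h1 := hu0 L hLm
      have h2 := (hb L hLm).1
      have : u L = 0 := by
        simp only [hu]
        rw [← h] at h1 h2 ⊢
        simp only [← h] at *
        linarith
      rw [this, ← h]; simp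
    · rw [hc0]; field_simp
  have e1 : c1 * (1 - R) = 1 - u R := by
    rcases hR.eq_or_lt with h | h
    · have h1 := hu1 R hRm
      have h2 := (ha R hRm).2
      have h3 : u R = 1 := by
        simp only [hu]
        simp only [h] at *
        linarith
      rw [h3, h]; simp
    · have : 1 - R ≠ 0 := by linarith
      rw [hc1, if_pos h]; field_simp
  have c0n : 0 ≤ c0 := div_nonneg (hu0 L hLm) hL
  have c0le : c0 ≤ a L + b L := by
    rcases hL.eq_or_lt with h | h
    · rw [hc0, ← h, div_zero]
      have := add_nonneg (ha L hLm).1 (hb L hLm).1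
      rw [← h] at this; exact this
    · rw [hc0, div_le_iff₀ h]
      simp only [hu]
      nlinarith [(hb L hLm).1]
  have c1ge : a R + b R ≤ c1 := by
    rcases hR.eq_or_lt with h | h
    · rw [hc1, if_neg (by linarith)]
      linarith [(ha R hRm).2, (hb R hRm).2]
    · rw [hc1, if_pos h, le_div_iff₀ (by linarith)]
      simp only [hu]
      nlinarith [(ha R hRm).2]
  have c1le : c1 ≤ 2 := by
    rcases hR.eq_or_lt with h | h
    · rw [hc1, h]; simp
    · rw [hc1, if_pos h, div_le_iff₀ (by linarith)]
      linarith [hu1 R hRm]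
  set C : ℝ → ℝ := fun s => if s < L then c0 else if s ≤ R then a s + b s else c1 with hC
  have CL : ∀ s, s < L → C s = c0 := fun s hs => by simp [hC, hs]
  have CM : ∀ s ∈ Icc L R, C s = a s + b s := fun s hs => by
    simp [hC, not_lt.2 hs.1, hs.2]
  have CR : ∀ s, R < s → C s = c1 := fun s hs => by
    simp [hC, not_lt.2 (hLR.trans hs).le, not_le.2 hs]
  have hge0 : ∀ s ∈ Icc L R, c0 ≤ a s + b s := fun s hs => c0le.trans (hmono hLm hs hs.1)
  have hle1 : ∀ s ∈ Icc L R, a s + b s ≤ c1 := fun s hs => (hmono hs hRm hs.2).trans c1ge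
  have htri : ∀ s, s < L ∨ s ∈ Icc L R ∨ R < s := fun s => by
    rcases lt_or_ge s L with h | h
    · exact Or.inl h
    rcases le_or_gt s R with h' | h'
    · exact Or.inr (Or.inl ⟨h, h'⟩)
    · exact Or.inr (Or.inr h')
  have c01 : c0 ≤ c1 := (hge0 L hLm).trans (hle1 L hLm)
  have hCm : Monotone C := by
    intro s t hst
    rcases htri s with h | h | h <;> rcases htri t with h' | h' | h'
    · rw [CL s h, CL t h']
    · rw [CL s h, CM t h']; exact hge0 t h'
    · rw [CL s h, CR t h']; exact c01
    · exact absurd h.1 (by linarith)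
    · rw [CM s h, CM t h']; exact hmono h h' hst
    · rw [CM s h, CR t h']; exact hle1 s h
    · linarith
    · linarith [h'.2]
    · rw [CR s h, CR t h']
  have hC0 : ∀ s, 0 ≤ C s := fun s => by
    rcases htri s with h | h | h
    · rw [CL s h]; exact c0n
    · rw [CM s h]; exact c0n.trans (hge0 s h)
    · rw [CR s h]; exact c0n.trans c01
  have hC2 : ∀ s, C s ≤ 2 := fun s => by
    rcases htri s with h | h | h
    · rw [CL s h]; exact c01.trans c1le
    · rw [CM s h]; exact (hle1 s h).trans c1le
    · rw [CR s h]; exact c1le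
  have hCint : ∀ (k : ℝ → ℝ) (p q : ℝ), IntervalIntegrable k volume p q →
      IntervalIntegrable (fun s => C s * k s) volume p q := by
    intro k p q hk
    rw [intervalIntegrable_iff] at hk ⊢
    refine Integrable.bdd_mul (c := 2) hk hCm.measurable.aestronglyMeasurable ?_
    refine Eventually.of_forall fun s => ?_
    rw [Real.norm_eq_abs, abs_of_nonneg (hC0 s)]
    exact hC2 s
  have hCi : ∀ p q, IntervalIntegrable C volume p q := fun p q => hCm.intervalIntegrable
  have hconst : ∀ p q, IntervalIntegrable (fun _ : ℝ => β / 2) volume p q := fun p q =>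
    intervalIntegrable_const
  have hB := bonnet (k := fun s => kk f s + β / 2) hCm hC0 hC2
    ((hf.kk_ii 0 1).add (hconst 0 1)) (M := α / 2 + β / 4) (by
      intro q hq
      rw [intervalIntegral.integral_add (hf.kk_ii q 1) (hconst q 1)]
      have h1 := hβ q hq
      rw [hf.GG_eq q] at h1
      simp only [intervalIntegral.integral_const, smul_eq_mul]
      linarith)
  have hsplit : ∫ s in (0:ℝ)..1, C s * (kk f s + β / 2)
      = (∫ s in (0:ℝ)..1, C s * kk f s) + (β / 2) * ∫ s in (0:ℝ)..1, C s := by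
    rw [← intervalIntegral.integral_const_mul, ← intervalIntegral.integral_add
      (hCint _ 0 1 (hf.kk_ii 0 1)) ((hCi 0 1).const_mul _)]
    congr 1
    ext s
    ring
  have hneL : ∀ᵐ s : ℝ, s ≠ L := by simp [ae_iff]
  have hderC : ∀ x ∈ Ioo L R \ S, HasDerivAt u (C x) x := by
    intro x hx
    rw [CM x (Ioo_subset_Icc_self hx.1)]
    exact hder x hx
  have hmidC : ∫ s in L..R, C s = u R - u L :=
    integral_eq_of_hasDerivAt_off_countable_of_le u C hLR.le hS hucont hderC (hCi L R)
  have hone : ∫ s in (0:ℝ)..1, C s = 1 := by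
    rw [← intervalIntegral.integral_add_adjacent_intervals (hCi 0 L) (hCi L 1),
      ← intervalIntegral.integral_add_adjacent_intervals (hCi L R) (hCi R 1), hmidC]
    have i1 : ∫ s in (0:ℝ)..L, C s = c0 * L := by
      have : ∫ s in (0:ℝ)..L, C s = ∫ s in (0:ℝ)..L, c0 := by
        refine intervalIntegral.integral_congr_ae ?_
        filter_upwards [hneL] with s hs hs1
        rw [uIoc_of_le hL] at hs1
        exact CL s (lt_of_le_of_ne hs1.2 hs)
      rw [this]; simp [mul_comm]
    have i2 : ∫ s in R..1, C s = c1 * (1 - R) := by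
      have : ∫ s in R..1, C s = ∫ s in R..1, c1 := by
        refine intervalIntegral.integral_congr_ae (Eventually.of_forall fun s hs1 => ?_)
        rw [uIoc_of_le hR] at hs1
        exact CR s hs1.1
      rw [this]; simp [mul_comm]
    rw [i1, i2, e0, e1]; ring
  have hkkI := fun p q => hCint _ p q (hf.kk_ii p q)
  have hkk : ∫ s in (0:ℝ)..1, C s * kk f s = ∫ s in L..R, C s * kk f s := by
    rw [← intervalIntegral.integral_add_adjacent_intervals (hkkI 0 L) (hkkI L 1),
      ← intervalIntegral.integral_add_adjacent_intervals (hkkI L R) (hkkI R 1)]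
    have i1 : ∫ s in (0:ℝ)..L, C s * kk f s = 0 := by
      refine intervalIntegral.integral_zero_ae ?_
      filter_upwards [hneL] with s hs hs1
      rw [uIoc_of_le hL] at hs1
      have hlt := lt_of_le_of_ne hs1.2 hs
      rw [kk, hf.KK_left hL hLR hR hs1.2, hf.zero_outside s (fun h => absurd h.1 (not_le.2 hlt))]
      ring
    have i2 : ∫ s in R..1, C s * kk f s = 0 := by
      refine intervalIntegral.integral_zero_ae (Eventually.of_forall fun s hs1 => ?_)
      rw [uIoc_of_le hR] at hs1
      rw [kk, hf.KK_right hR hs1.1.le hs1.2,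
        hf.zero_outside s (fun h => absurd h.2 (not_le.2 hs1.1))]
      ring
    rw [i1, i2]; ring
  have hfuI : IntervalIntegrable (fun s => u s * ((2 * s - 1) * f s)) volume L R := by
    refine ContinuousOn.intervalIntegrable ?_
    rw [uIcc_of_le hLR.le]
    have := hf.contOn
    fun_prop
  have hCK : IntervalIntegrable (fun s => C s * KK f s) volume L R :=
    hCint _ L R (hf.KK_cont.intervalIntegrable _ _)
  have hparts : ∫ s in L..R, (C s * KK f s - u s * ((2 * s - 1) * f s)) = 0 := by
    have := integral_eq_of_hasDerivAt_off_countable_of_le (fun s => u s * KK f s)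
      (fun s => C s * KK f s - u s * ((2 * s - 1) * f s)) hLR.le hS
      (hucont.mul hf.KK_cont.continuousOn) (by
        intro x hx
        have d1 := hderC x hx
        have d2 : HasDerivAt (KK f) (-((2 * x - 1) * f x)) x :=
          hf.tail_deriv (g := fun s => 2 * s - 1) (by fun_prop) hx.1.1.ne' hx.1.2.ne
        exact (d1.mul d2).congr_deriv (by ring)) (hCK.sub hfuI)
    rw [this, hf.KK_left hL hLR hR le_rfl, hf.KK_right hR le_rfl hR]
    ring
  have hpt : ∀ s ∈ Icc L R, (s * a s + (1 - s) * b s) * f s =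
      C s * kk f s - (C s * KK f s - u s * ((2 * s - 1) * f s)) := by
    intro s hs
    rw [CM s hs]
    simp only [kk, hu]
    ring
  have hI := (hkkI L R).sub (hCK.sub hfuI)
  constructor
  · refine hI.congr fun s hs => ?_
    rw [uIoc_of_le hLR.le] at hs
    exact (hpt s (Ioc_subset_Icc_self hs)).symm
  · have : ∫ s in L..R, (s * a s + (1 - s) * b s) * f s =
        ∫ s in L..R, (C s * kk f s - (C s * KK f s - u s * ((2 * s - 1) * f s))) := by
      refine intervalIntegral.integral_congr fun s hs => ?_
      rw [uIcc_of_le hLR.le] at hs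
      exact hpt s hs
    rw [this, intervalIntegral.integral_sub (hkkI L R) (hCK.sub hfuI), hparts, ← hkk]
    rw [hsplit, hone] at hB
    linarith

theorem upper (hL : 0 ≤ L) (hLR : L < R) (hR : R ≤ 1) (hf : Density f f' L R) {a b : ℝ → ℝ}
    (ha : ∀ s ∈ Icc L R, a s ∈ Icc (0:ℝ) 1) (hb : ∀ s ∈ Icc L R, b s ∈ Icc (0:ℝ) 1)
    (hu0 : ∀ s ∈ Icc L R, 0 ≤ s * a s - (1 - s) * b s)
    (hIC : ∀ s ∈ Icc L R, ∀ t ∈ Icc L R, s * a t - (1 - s) * b t ≤ s * a s - (1 - s) * b s)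
    {α : ℝ} (hα : ∀ q1 ∈ Ico (0:ℝ) (1/2), ∀ q2 ∈ Ioc (1/2:ℝ) 1,
      (q2 - 1/2) * GG f q1 + (1/2 - q1) * GG f q2 ≤ α * (q2 - q1)) :
    ∫ s in L..R, (s * a s + (1 - s) * b s) * f s ≤ α := by
  classical
  set P : ℝ → Prop := fun s => s * a s - (1 - s) * b s < 2 * s - 1 with hP
  set a' : ℝ → ℝ := fun s => if P s then 1 else a s with ha'
  set b' : ℝ → ℝ := fun s => if P s then 1 else b s with hb'
  have hcase : ∀ s, (P s ∧ a' s = 1 ∧ b' s = 1) ∨ (¬ P s ∧ a' s = a s ∧ b' s = b s) := by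
    intro s
    by_cases h : P s
    · left; simp [ha', hb', h]
    · right; simp [ha', hb', h]
  have key := upper0 hL hLR hR hf (a := a') (b := b')
    (fun s hs => by
      rcases hcase s with ⟨-, h, -⟩ | ⟨-, h, -⟩ <;> rw [h]
      · simp
      · exact ha s hs)
    (fun s hs => by
      rcases hcase s with ⟨-, -, h⟩ | ⟨-, -, h⟩ <;> rw [h]
      · simp
      · exact hb s hs)
    (fun s hs => by
      rcases hcase s with ⟨h0, h, h'⟩ | ⟨-, h, h'⟩ <;> rw [h, h']
      · have := hu0 s hs
        simp only [hP] at h0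
        linarith
      · exact hu0 s hs)
    (fun s hs => by
      rcases hcase s with ⟨h0, h, h'⟩ | ⟨h0, h, h'⟩ <;> rw [h, h']
      · linarith
      · simp only [hP, not_lt] at h0
        exact h0)
    (fun s hs t ht => by
      have := hIC s hs t ht
      rcases hcase s with ⟨h0, h, h'⟩ | ⟨h0, h, h'⟩ <;>
      rcases hcase t with ⟨k0, k, k'⟩ | ⟨k0, k, k'⟩ <;> rw [h, h', k, k'] <;>
      simp only [hP, not_lt] at h0 k0 <;> linarith)
    hα
  refine le_trans ?_ key.2
  rw [intervalIntegral.integral_of_le hLR.le, intervalIntegral.integral_of_le hLR.le]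
  refine integral_mono_of_nonneg ?_
    ((intervalIntegrable_iff_integrableOn_Ioc_of_le hLR.le).1 key.1) ?_
  · filter_upwards [ae_restrict_mem measurableSet_Ioc] with s hs
    have hs' := Ioc_subset_Icc_self hs
    have h1 := (ha s hs').1
    have h2 := (hb s hs').1
    have h3 : 0 ≤ s := hL.trans hs'.1
    have h4 : 0 ≤ 1 - s := by linarith [hs'.2]
    have h5 := hf.nonneg s
    simp only [Pi.zero_apply]
    positivity
  · filter_upwards [ae_restrict_mem measurableSet_Ioc] with s hs
    have hs' := Ioc_subset_Icc_self hs
    refine mul_le_mul_of_nonneg_right ?_ (hf.nonneg s)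
    have h3 : 0 ≤ s := hL.trans hs'.1
    have h4 : 0 ≤ 1 - s := by linarith [hs'.2]
    rcases hcase s with ⟨h0, h, h'⟩ | ⟨h0, h, h'⟩ <;> rw [h, h']
    nlinarith [(ha s hs').2, (hb s hs').2]
end partB
section partC
variable {f f' : ℝ → ℝ} {L R : ℝ}

theorem cube_meas (m : ℕ) : MeasurableSet (cube m) :=
  MeasurableSet.univ_pi fun _ => measurableSet_Icc

theorem cube_restrict (m : ℕ) : (volume : Measure (Fin m → ℝ)).restrict (cube m)
    = Measure.pi (fun _ : Fin m => (volume : Measure ℝ).restrict (Icc 0 1)) := by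
  rw [cube, volume_pi, Measure.restrict_pi_pi]

theorem cube_prod (m : ℕ) (g : ℝ → ℝ) :
    ∫ y in cube m, ∏ k, g (y k) = (∫ s in (0:ℝ)..1, g s) ^ m := by
  rw [cube_restrict, integral_fintype_prod_eq_pow, Fintype.card_fin,
    intervalIntegral.integral_of_le zero_le_one, integral_Icc_eq_integral_Ioc]

theorem Density.cube_int (hf : Density f f' L R) (m : ℕ) {g : ℝ → ℝ} (hg : Continuous g) :
    IntegrableOn (fun y : Fin m → ℝ => ∏ k, g (y k) * f (y k)) (cube m) := by
  rw [IntegrableOn, cube_restrict]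
  exact Integrable.fintype_prod (f := fun _ s => g s * f s) fun _ => (hf.int hg).integrableOn

theorem Density.wp_int (hf : Density f f' L R) (m : ℕ) : IntegrableOn (wplus f) (cube m) :=
  hf.cube_int m (g := fun s => s) continuous_id

theorem Density.wm_int (hf : Density f f' L R) (m : ℕ) : IntegrableOn (wminus f) (cube m) :=
  hf.cube_int m (g := fun s => 1 - s) (by fun_prop)

theorem Density.wp_val (hf : Density f f' L R) (hL : 0 ≤ L) (hLR : L < R) (hR : R ≤ 1) (m : ℕ) :
    2 ^ m * ∫ y in cube m, wplus f y = 1 := by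
  unfold wplus
  rw [cube_prod m (fun s => s * f s), hf.full hL hLR hR hL hR (fun s => s), hf.mean, ← mul_pow]
  norm_num

theorem Density.wm_val (hf : Density f f' L R) (hL : 0 ≤ L) (hLR : L < R) (hR : R ≤ 1) (m : ℕ) :
    2 ^ m * ∫ y in cube m, wminus f y = 1 := by
  unfold wminus
  rw [cube_prod m (fun s => (1 - s) * f s), hf.full hL hLR hR hL hR (fun s => 1 - s), ]
  have : ∫ s in L..R, (1 - s) * f s = 1 / 2 := by
    have : ∀ t, (1 - t) * f t = f t - t * f t := fun t => by ring
    simp_rw [this]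
    rw [intervalIntegral.integral_sub, hf.mean, hf.total]
    · norm_num
    · simpa using hf.ii (g := fun s => 1) continuous_const L R
    · exact hf.ii (g := fun s => s) continuous_id L R
  rw [this, ← mul_pow]
  norm_num

theorem wp_nonneg (hf : Density f f' L R) {m : ℕ} {y : Fin m → ℝ} (hy : y ∈ cube m) :
    0 ≤ wplus f y :=
  Finset.prod_nonneg fun k _ => mul_nonneg (hy k (mem_univ k)).1 (hf.nonneg _)

theorem wm_nonneg (hf : Density f f' L R) {m : ℕ} {y : Fin m → ℝ} (hy : y ∈ cube m) :
    0 ≤ wminus f y :=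
  Finset.prod_nonneg fun k _ => mul_nonneg (sub_nonneg.2 (hy k (mem_univ k)).2) (hf.nonneg _)

theorem int_bounds {m : ℕ} {w z : (Fin m → ℝ) → ℝ} (hw : IntegrableOn w (cube m))
    (hw0 : ∀ y ∈ cube m, 0 ≤ w y) (hz : ∀ y, z y ∈ Icc (0:ℝ) 1)
    (hv : 2 ^ m * ∫ y in cube m, w y = 1) :
    2 ^ m * (∫ y in cube m, z y * w y) ∈ Icc (0:ℝ) 1 := by
  constructor
  · refine mul_nonneg (by positivity) (setIntegral_nonneg (cube_meas m) fun y hy => ?_)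
    exact mul_nonneg (hz y).1 (hw0 y hy)
  · rw [← hv]
    refine mul_le_mul_of_nonneg_left ?_ (by positivity)
    refine integral_mono_of_nonneg ?_ hw ?_
    · filter_upwards [ae_restrict_mem (cube_meas m)] with y hy
      exact mul_nonneg (hz y).1 (hw0 y hy)
    · filter_upwards [ae_restrict_mem (cube_meas m)] with y hy
      exact mul_le_of_le_one_left (hw0 y hy) (hz y).2

def II {m : ℕ} (τ : ℝ) (y : Fin m → ℝ) : ℝ := if τ * ∏ k, (1 - y k) ≤ ∏ k, y k then 1 else 0

theorem II_mem {m : ℕ} (τ : ℝ) (y : Fin m → ℝ) : II τ y ∈ Icc (0:ℝ) 1 := by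
  unfold II; split_ifs <;> simp

theorem II_meas {m : ℕ} (τ : ℝ) : Measurable (II τ : (Fin m → ℝ) → ℝ) := by
  unfold II
  refine Measurable.ite (measurableSet_le ?_ ?_) measurable_const measurable_const <;> fun_prop

def Pp (f : ℝ → ℝ) (m : ℕ) (τ : ℝ) : ℝ := 2 ^ m * ∫ y in cube m, II τ y * wplus f y
def Pm (f : ℝ → ℝ) (m : ℕ) (τ : ℝ) : ℝ := 2 ^ m * ∫ y in cube m, II τ y * wminus f y

theorem II_int {m : ℕ} {w : (Fin m → ℝ) → ℝ} (hw : IntegrableOn w (cube m)) (τ : ℝ) :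
    IntegrableOn (fun y => II τ y * w y) (cube m) := by
  refine Integrable.bdd_mul (c := 1) hw (II_meas τ).aestronglyMeasurable
    (Eventually.of_forall fun y => ?_)
  rw [Real.norm_eq_abs, abs_of_nonneg (II_mem τ y).1]
  exact (II_mem τ y).2

def rho (f : ℝ → ℝ) : ℝ := 2 * ∫ s in (0:ℝ)..1, √(s * (1 - s)) * f s

theorem rho_nonneg (hf : Density f f' L R) : 0 ≤ rho f := by
  refine mul_nonneg (by norm_num) (intervalIntegral.integral_nonneg zero_le_one fun s _ => ?_)
  exact mul_nonneg (Real.sqrt_nonneg _) (hf.nonneg s)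

theorem rho_lt (hf : Density f f' L R) (hL : 0 ≤ L) (hLR : L < R) (hR : R ≤ 1) : rho f < 1 := by
  unfold rho
  rw [hf.full hL hLR hR hL hR (fun s => √(s * (1 - s))), ← intervalIntegral.integral_const_mul]
  refine lt_of_lt_of_eq ?_ hf.total
  have hsq : ∀ s : ℝ, 2 * √(s * (1 - s)) ≤ 1 := by
    intro s
    have : √(s * (1 - s)) ≤ 1 / 2 := by
      rw [Real.sqrt_le_left (by norm_num)]
      nlinarith [sq_nonneg (s - 1/2)]
    linarith
  refine intervalIntegral.integral_lt_integral_of_continuousOn_of_le_of_exists_lt hLR ?_ ?_ ?_ ?_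
  · have := hf.contOn
    fun_prop
  · exact hf.contOn
  · intro s hs
    nlinarith [hf.nonneg s, hsq s]
  · have : ∃ s ∈ Icc L R, s ≠ 1/2 := by
      by_cases h : L = 1/2
      · exact ⟨R, ⟨hLR.le, le_rfl⟩, by linarith⟩
      · exact ⟨L, ⟨le_rfl, hLR.le⟩, h⟩
    obtain ⟨s, hs, hne⟩ := this
    refine ⟨s, hs, ?_⟩
    have h1 : √(s * (1 - s)) < 1 / 2 := by
      rw [Real.sqrt_lt' (by norm_num)]
      have : 0 < (s - 1/2)^2 := by
        have : s - 1/2 ≠ 0 := sub_ne_zero.2 hne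
        positivity
      nlinarith
    nlinarith [hf.pos s hs]

theorem rho_pow (f : ℝ → ℝ) (m : ℕ) :
    2 ^ m * ∫ y in cube m, ∏ k, (√(y k * (1 - y k)) * f (y k)) = rho f ^ m := by
  rw [cube_prod m (fun s => √(s * (1 - s)) * f s), rho, mul_pow]

theorem sqrt_bound (hf : Density f f' L R) {m : ℕ} {y : Fin m → ℝ} (hy : y ∈ cube m) :
    II 1 y * wminus f y ≤ ∏ k, (√(y k * (1 - y k)) * f (y k)) ∧
    (1 - II 1 y) * wplus f y ≤ ∏ k, (√(y k * (1 - y k)) * f (y k)) := by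
  have hf0 : 0 ≤ ∏ k, f (y k) := Finset.prod_nonneg fun k _ => hf.nonneg _
  have hp : 0 ≤ ∏ k, y k := Finset.prod_nonneg fun k _ => (hy k (mem_univ k)).1
  have hq : 0 ≤ ∏ k, (1 - y k) :=
    Finset.prod_nonneg fun k _ => sub_nonneg.2 (hy k (mem_univ k)).2
  have e : ∏ k, √(y k * (1 - y k)) = √((∏ k, y k) * ∏ k, (1 - y k)) := by
    rw [← Finset.prod_mul_distrib, Real.sqrt_prod]
    intro k _
    exact mul_nonneg (hy k (mem_univ k)).1 (sub_nonneg.2 (hy k (mem_univ k)).2)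
  rw [wplus, wminus, Finset.prod_mul_distrib, Finset.prod_mul_distrib, Finset.prod_mul_distrib, e]
  have hs := Real.sqrt_nonneg ((∏ k, y k) * ∏ k, (1 - y k))
  unfold II
  rw [one_mul]
  split_ifs with h
  · constructor
    · rw [one_mul]
      refine mul_le_mul_of_nonneg_right ?_ hf0
      apply Real.le_sqrt_of_sq_le
      nlinarith
    · rw [sub_self, zero_mul]; positivity
  · push Not at h
    constructor
    · rw [zero_mul]; positivity
    · rw [sub_zero, one_mul]
      refine mul_le_mul_of_nonneg_right ?_ hf0
      apply Real.le_sqrt_of_sq_le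
      nlinarith

theorem sq_int (hf : Density f f' L R) (m : ℕ) :
    IntegrableOn (fun y : Fin m → ℝ => ∏ k, (√(y k * (1 - y k)) * f (y k))) (cube m) :=
  hf.cube_int m (g := fun s => √(s * (1 - s))) (by fun_prop)

theorem Pm_one (hf : Density f f' L R) (m : ℕ) : Pm f m 1 ≤ rho f ^ m := by
  rw [← rho_pow, Pm]
  refine mul_le_mul_of_nonneg_left ?_ (by positivity)
  exact setIntegral_mono_on (II_int (hf.wm_int m) 1) (sq_int hf m) (cube_meas m)
    fun y hy => (sqrt_bound hf hy).1

theorem Pp_one (hf : Density f f' L R) (hL : 0 ≤ L) (hLR : L < R) (hR : R ≤ 1) (m : ℕ) :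
    1 - rho f ^ m ≤ Pp f m 1 := by
  have : 1 ≤ Pp f m 1 + rho f ^ m := by
    refine (hf.wp_val hL hLR hR m).symm.le.trans ?_
    rw [← rho_pow, Pp, ← mul_add,
      ← integral_add (II_int (hf.wp_int m) 1) (sq_int hf m)]
    refine mul_le_mul_of_nonneg_left ?_ (by positivity)
    refine setIntegral_mono_on (hf.wp_int m)
      ((II_int (hf.wp_int m) 1).add (sq_int hf m)) (cube_meas m) fun y hy => ?_
    have := (sqrt_bound hf hy).2
    linarith
  linarith

theorem II_anti {m : ℕ} {y : Fin m → ℝ} (hy : y ∈ cube m) {σ τ : ℝ} (h : σ ≤ τ) :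
    II τ y ≤ II σ y := by
  have hq : 0 ≤ ∏ k, (1 - y k) :=
    Finset.prod_nonneg fun k _ => sub_nonneg.2 (hy k (mem_univ k)).2
  unfold II
  split_ifs with h1 h2
  · rfl
  · exact absurd ((mul_le_mul_of_nonneg_right h hq).trans h1) h2
  · norm_num
  · rfl

theorem Pp_anti (hf : Density f f' L R) (m : ℕ) {σ τ : ℝ} (h : σ ≤ τ) :
    Pp f m τ ≤ Pp f m σ := by
  refine mul_le_mul_of_nonneg_left ?_ (by positivity)
  exact setIntegral_mono_on (II_int (hf.wp_int m) τ) (II_int (hf.wp_int m) σ) (cube_meas m)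
    fun y hy => mul_le_mul_of_nonneg_right (II_anti hy h) (wp_nonneg hf hy)

theorem Pm_zero (hf : Density f f' L R) (hL : 0 ≤ L) (hLR : L < R) (hR : R ≤ 1) (m : ℕ) :
    Pm f m 0 = 1 := by
  rw [← hf.wm_val hL hLR hR m, Pm]
  congr 1
  refine setIntegral_congr_fun (cube_meas m) fun y hy => ?_
  have hp : 0 ≤ ∏ k, y k := Finset.prod_nonneg fun k _ => (hy k (mem_univ k)).1
  simp [II, hp]

theorem null_set (m : ℕ) (hm : 1 ≤ m) {τ : ℝ} (hτ : 0 ≤ τ) :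
    ∀ᵐ y ∂(volume : Measure (Fin m → ℝ)).restrict (cube m),
      τ * ∏ k, (1 - y k) ≠ ∏ k, y k := by
  obtain ⟨j, rfl⟩ : ∃ j, m = j + 1 := ⟨m - 1, by omega⟩
  set S : Set (ℝ × (Fin j → ℝ)) := {p | τ * ((1 - p.1) * ∏ k, (1 - p.2 k)) = p.1 * ∏ k, p.2 k ∧
    ∀ k, 0 < p.2 k ∧ p.2 k ≤ 1} with hS
  have hSm : MeasurableSet S := by
    refine MeasurableSet.inter (measurableSet_eq_fun (by fun_prop) (by fun_prop)) ?_
    have : {p : ℝ × (Fin j → ℝ) | ∀ k, 0 < p.2 k ∧ p.2 k ≤ 1}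
        = ⋂ k, {p : ℝ × (Fin j → ℝ) | 0 < p.2 k ∧ p.2 k ≤ 1} := by
      ext p; simp
    change MeasurableSet {p : ℝ × (Fin j → ℝ) | ∀ k, 0 < p.2 k ∧ p.2 k ≤ 1}
    rw [this]
    refine MeasurableSet.iInter fun k => ?_
    have m1 : MeasurableSet {p : ℝ × (Fin j → ℝ) | 0 < p.2 k} :=
      measurableSet_lt (by fun_prop) (by fun_prop)
    have m2 : MeasurableSet {p : ℝ × (Fin j → ℝ) | p.2 k ≤ 1} :=
      measurableSet_le (by fun_prop) (by fun_prop)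
    exact m1.inter m2
  have hS0 : (volume : Measure (ℝ × (Fin j → ℝ))) S = 0 := by
    rw [Measure.volume_eq_prod, Measure.prod_apply_symm hSm]
    refine (lintegral_congr fun z => ?_).trans lintegral_zero
    refine Set.Subsingleton.measure_zero ?_ _
    rintro s ⟨hs, hz⟩ t ⟨ht, -⟩
    simp only at hs ht hz
    have hp : 0 < ∏ k, z k := Finset.prod_pos fun k _ => (hz k).1
    have hq : 0 ≤ ∏ k, (1 - z k) := Finset.prod_nonneg fun k _ => sub_nonneg.2 (hz k).2
    have h3 : (s - t) * (∏ k, z k + τ * ∏ k, (1 - z k)) = 0 := by linarith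
    have h4 : 0 < ∏ k, z k + τ * ∏ k, (1 - z k) := by positivity
    rcases mul_eq_zero.1 h3 with h | h
    · linarith
    · linarith
  have mp := volume_preserving_piFinSuccAbove (fun _ : Fin (j + 1) => ℝ) 0
  have h1 := mp.quasiMeasurePreserving.preimage_null hS0
  have hz : ∀ᵐ y ∂(volume : Measure (Fin (j + 1) → ℝ)), ∀ k, y k ≠ 0 := by
    rw [ae_all_iff]
    intro k
    rw [ae_iff]
    simp only [not_not]
    exact Measure.pi_hyperplane _ k 0
  filter_upwards [ae_restrict_mem (cube_meas (j + 1)), ae_restrict_of_ae hz,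
    ae_restrict_of_ae (measure_eq_zero_iff_ae_notMem.1 h1)] with y hy hy0 hyS heq
  apply hyS
  rw [mem_preimage, hS]
  refine ⟨?_, fun k => ?_⟩
  · rw [Fin.prod_univ_succ, Fin.prod_univ_succ] at heq
    exact heq
  · have := hy k.succ (mem_univ _)
    exact ⟨lt_of_le_of_ne this.1 (Ne.symm (hy0 k.succ)), this.2⟩

theorem Pm_cont (hf : Density f f' L R) (m : ℕ) (hm : 1 ≤ m) : ContinuousOn (Pm f m) (Icc 0 1) := by
  intro τ hτ
  refine ContinuousAt.continuousWithinAt ?_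
  refine ContinuousAt.const_mul ?_ _
  refine continuousAt_of_dominated (bound := fun y => ‖wminus f y‖) ?_ ?_ (hf.wm_int m).norm ?_
  · exact Eventually.of_forall fun σ => (II_int (hf.wm_int m) σ).aestronglyMeasurable
  · refine Eventually.of_forall fun σ => Eventually.of_forall fun y => ?_
    rw [norm_mul, Real.norm_eq_abs (II σ y), abs_of_nonneg (II_mem σ y).1]
    exact mul_le_of_le_one_left (norm_nonneg _) (II_mem σ y).2
  · filter_upwards [null_set m hm hτ.1] with y hy
    refine ContinuousAt.mul ?_ continuousAt_const
    have hc : ContinuousAt (fun σ : ℝ => σ * ∏ k, (1 - y k)) τ := by fun_prop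
    rcases lt_or_gt_of_ne hy with h | h
    · have : (fun σ => II σ y) =ᶠ[nhds τ] fun _ => 1 := by
        filter_upwards [hc.eventually_lt continuousAt_const h] with σ hσ
        simp [II, hσ.le]
      exact continuousAt_const.congr this.symm
    · have : (fun σ => II σ y) =ᶠ[nhds τ] fun _ => 0 := by
        filter_upwards [continuousAt_const.eventually_lt hc h] with σ hσ
        simp [II, hσ]
      exact continuousAt_const.congr this.symm

theorem Pp_mem (hf : Density f f' L R) (hL : 0 ≤ L) (hLR : L < R) (hR : R ≤ 1) (m : ℕ) (τ : ℝ) :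
    Pp f m τ ∈ Icc (0:ℝ) 1 :=
  int_bounds (hf.wp_int m) (fun _ hy => wp_nonneg hf hy) (II_mem τ) (hf.wp_val hL hLR hR m)

theorem Pm_mem (hf : Density f f' L R) (hL : 0 ≤ L) (hLR : L < R) (hR : R ≤ 1) (m : ℕ) (τ : ℝ) :
    Pm f m τ ∈ Icc (0:ℝ) 1 :=
  int_bounds (hf.wm_int m) (fun _ hy => wm_nonneg hf hy) (II_mem τ) (hf.wm_val hL hLR hR m)

theorem tests (hf : Density f f' L R) (hL : 0 ≤ L) (hLR : L < R) (hR : R ≤ 1) {b : ℝ}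
    (hb : b ∈ Icc (0:ℝ) 1) : ∃ τ : ℕ → ℝ, (∀ m, 0 ≤ τ m) ∧
    Tendsto (fun m => Pp f m (τ m)) atTop (nhds 1) ∧
    Tendsto (fun m => Pm f m (τ m)) atTop (nhds b) := by
  have h : ∀ m, ∃ τ ∈ Icc (0:ℝ) 1, 1 ≤ m → Pm f m τ = max b (Pm f m 1) := by
    intro m
    by_cases hm : 1 ≤ m
    · have := intermediate_value_Icc' zero_le_one (Pm_cont hf m hm)
      rw [Pm_zero hf hL hLR hR] at this
      obtain ⟨τ, h1, h2⟩ := this ⟨le_max_right b _, max_le hb.2 (Pm_mem hf hL hLR hR m 1).2⟩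
      exact ⟨τ, h1, fun _ => h2⟩
    · exact ⟨0, by simp, fun h => absurd h hm⟩
  choose τ h1 h2 using h
  have hr : Tendsto (fun m => rho f ^ m) atTop (nhds 0) :=
    tendsto_pow_atTop_nhds_zero_of_lt_one (rho_nonneg hf) (rho_lt hf hL hLR hR)
  refine ⟨τ, fun m => (h1 m).1, ?_, ?_⟩
  · refine tendsto_of_tendsto_of_tendsto_of_le_of_le (g := fun m => 1 - rho f ^ m)
      (h := fun _ => 1) (by simpa using hr.const_sub 1) tendsto_const_nhds ?_ ?_
    · intro m
      exact (Pp_one hf hL hLR hR m).trans (Pp_anti hf m (h1 m).2)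
    · intro m
      exact (Pp_mem hf hL hLR hR m _).2
  · have h3 : Tendsto (fun m => Pm f m 1) atTop (nhds 0) :=
      squeeze_zero (fun m => (Pm_mem hf hL hLR hR m 1).1) (Pm_one hf) hr
    have h4 : Tendsto (fun m => max b (Pm f m 1)) atTop (nhds (max b 0)) :=
      tendsto_const_nhds.max h3
    rw [max_eq_left hb.1] at h4
    refine h4.congr' ?_
    filter_upwards [eventually_ge_atTop 1] with m hm
    exact (h2 m hm).symm
end partC
section partD
variable {f f' : ℝ → ℝ} {L R : ℝ}

def XX (m : ℕ) (smin smax κ τ : ℝ) (s : ℝ) (y : Fin m → ℝ) : ℝ :=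
  if s < smin then 0
  else if s < smax then
    (if τ * ∏ k, (1 - y k) ≤ ∏ k, y k then κ else 0)
  else 1

def menu (q1 q2 a s : ℝ) : ℝ := if s < q1 then 0 else if s < q2 then a else 1

theorem XX_A (hf : Density f f' L R) (hL : 0 ≤ L) (hLR : L < R) (hR : R ≤ 1) (m : ℕ)
    (q1 q2 κ τ t : ℝ) :
    2 ^ m * Amap f (XX m q1 q2 κ τ) t = menu q1 q2 (κ * Pp f m τ) t := by
  unfold Amap XX menu
  split_ifs with h1 h2
  · simp
  · rw [Pp, mul_left_comm κ]
    congr 1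
    rw [← integral_const_mul κ (fun y => II τ y * wplus f y)]
    refine integral_congr_ae (Eventually.of_forall fun y => ?_)
    simp only [II]
    split_ifs <;> ring
  · simp [hf.wp_val hL hLR hR]

theorem XX_B (hf : Density f f' L R) (hL : 0 ≤ L) (hLR : L < R) (hR : R ≤ 1) (m : ℕ)
    (q1 q2 κ τ t : ℝ) :
    2 ^ m * Bmap f (XX m q1 q2 κ τ) t = menu q1 q2 (κ * Pm f m τ) t := by
  unfold Bmap XX menu
  split_ifs with h1 h2
  · simp
  · rw [Pm, mul_left_comm κ]
    congr 1
    rw [← integral_const_mul κ (fun y => II τ y * wminus f y)]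
    refine integral_congr_ae (Eventually.of_forall fun y => ?_)
    simp only [II]
    split_ifs <;> ring
  · simp [hf.wm_val hL hLR hR]

theorem XX_mech (m : ℕ) (q1 q2 κ τ : ℝ) (hκ : κ ∈ Icc (0:ℝ) 1) : IsMechanism (XX m q1 q2 κ τ) := by
  constructor
  · unfold XX Function.uncurry
    refine Measurable.ite (measurableSet_lt (by fun_prop) (by fun_prop)) measurable_const ?_
    refine Measurable.ite (measurableSet_lt (by fun_prop) (by fun_prop)) ?_ measurable_const
    refine Measurable.ite (measurableSet_le ?_ ?_) measurable_const measurable_const <;> fun_prop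
  · intro s y
    unfold XX
    split_ifs
    · simp
    · exact hκ
    · simp
    · simp

theorem XX_feas (hf : Density f f' L R) (hL : 0 ≤ L) (hLR : L < R) (hR : R ≤ 1) (m : ℕ)
    (q1 q2 κ τ a b : ℝ) (hκ : κ ∈ Icc (0:ℝ) 1) (ha : a = κ * Pp f m τ) (hb : b = κ * Pm f m τ)
    (h1 : ∀ s, s < q1 → s * a - (1 - s) * b ≤ 0 ∧ 2 * s - 1 ≤ 0)
    (h2 : ∀ s, q1 ≤ s → s < q2 → 0 ≤ s * a - (1 - s) * b ∧ 2 * s - 1 ≤ s * a - (1 - s) * b)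
    (h3 : ∀ s, q1 ≤ s → q2 ≤ s → 0 ≤ 2 * s - 1 ∧ s * a - (1 - s) * b ≤ 2 * s - 1) :
    Feasible f L R (XX m q1 q2 κ τ) := by
  have hU : ∀ t s, Upay f (XX m q1 q2 κ τ) t s = s * menu q1 q2 a t - (1 - s) * menu q1 q2 b t := by
    intro t s
    rw [ha, hb, ← XX_A hf hL hLR hR, ← XX_B hf hL hLR hR, Upay]
    ring
  refine ⟨XX_mech m q1 q2 κ τ hκ, fun s _ => ?_, fun s _ t _ => ?_⟩
  · rw [hU]
    unfold menu
    split_ifs with c1 c2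
    · simp
    · exact (h2 s (not_lt.1 c1) c2).1
    · linarith [(h3 s (not_lt.1 c1) (not_lt.1 c2)).1]
  · rw [hU, hU]
    have key : ∀ v, 0 ≤ v → s * a - (1 - s) * b ≤ v → 2 * s - 1 ≤ v →
        s * menu q1 q2 a t - (1 - s) * menu q1 q2 b t ≤ v := by
      intro v v0 v1 v2
      unfold menu
      split_ifs <;> linarith
    apply key <;> unfold menu <;> split_ifs with c1 c2
    · simp
    · exact (h2 s (not_lt.1 c1) c2).1
    · linarith [(h3 s (not_lt.1 c1) (not_lt.1 c2)).1]
    · linarith [(h1 s c1).1]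
    · rfl
    · linarith [(h3 s (not_lt.1 c1) (not_lt.1 c2)).2]
    · linarith [(h1 s c1).2]
    · exact (h2 s (not_lt.1 c1) c2).2
    · linarith

theorem piece {p q : ℝ} (hpq : p ≤ q) {h h' : ℝ → ℝ} (hh' : IntervalIntegrable h' volume p q)
    (he : ∀ s ∈ Ico p q, h s = h' s) :
    IntervalIntegrable h volume p q ∧ ∫ s in p..q, h s = ∫ s in p..q, h' s := by
  have hne : ∀ᵐ s : ℝ, s ≠ q := by simp [ae_iff]
  have hae : ∀ᵐ s : ℝ, s ∈ uIoc p q → h s = h' s := by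
    filter_upwards [hne] with s hs hs1
    rw [uIoc_of_le hpq] at hs1
    exact he s ⟨hs1.1.le, lt_of_le_of_ne hs1.2 hs⟩
  refine ⟨?_, intervalIntegral.integral_congr_ae hae⟩
  refine hh'.congr_ae ?_
  rw [EventuallyEq, ae_restrict_iff' measurableSet_uIoc]
  filter_upwards [hae] with s hs h1
  exact (hs h1).symm

theorem menu_value (hf : Density f f' L R) (hL : 0 ≤ L) (hLR : L < R) (hR : R ≤ 1)
    {q1 q2 a b : ℝ} (h0 : 0 ≤ q1) (h12 : q1 ≤ q2) (h1 : q2 ≤ 1) :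
    ∫ s in L..R, (s * menu q1 q2 a s + (1 - s) * menu q1 q2 b s) * f s
      = a * (∫ s in q1..q2, s * f s) + b * (∫ s in q1..q2, (1 - s) * f s)
        + ((∫ s in q2..1, s * f s) + ∫ s in q2..1, (1 - s) * f s) := by
  rw [← hf.full hL hLR hR hL hR]
  have i1 := fun p q => hf.ii (g := fun s => s) continuous_id p q
  have i2 := fun p q => hf.ii (g := fun s => 1 - s) (by fun_prop) p q
  obtain ⟨p1, e1⟩ := piece h0
    (h := fun s => (s * menu q1 q2 a s + (1 - s) * menu q1 q2 b s) * f s) (h' := fun _ => 0)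
    intervalIntegrable_const (fun s hs => by simp [menu, hs.2])
  obtain ⟨p2, e2⟩ := piece h12
    (h := fun s => (s * menu q1 q2 a s + (1 - s) * menu q1 q2 b s) * f s)
    (h' := fun s => a * (s * f s) + b * ((1 - s) * f s))
    (((i1 q1 q2).const_mul a).add ((i2 q1 q2).const_mul b)) (fun s hs => by
      simp only [menu, not_lt.2 hs.1, hs.2, if_true, if_false]; ring)
  obtain ⟨p3, e3⟩ := piece h1
    (h := fun s => (s * menu q1 q2 a s + (1 - s) * menu q1 q2 b s) * f s)
    (h' := fun s => s * f s + (1 - s) * f s)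
    ((i1 q2 1).add (i2 q2 1)) (fun s hs => by
      simp only [menu, not_lt.2 hs.1, not_lt.2 (h12.trans hs.1), if_false]; ring)
  rw [← intervalIntegral.integral_add_adjacent_intervals p1 (p2.trans p3),
    ← intervalIntegral.integral_add_adjacent_intervals p2 p3, e1, e2, e3,
    intervalIntegral.integral_add ((i1 q1 q2).const_mul a) ((i2 q1 q2).const_mul b),
    intervalIntegral.integral_add (i1 q2 1) (i2 q2 1), intervalIntegral.integral_const_mul,
    intervalIntegral.integral_const_mul]
  simp

def MM (f : ℝ → ℝ) (q1 q2 : ℝ) : ℝ :=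
  ((q2 - 1/2) * GG f q1 + (1/2 - q1) * GG f q2) / (q2 - q1)

theorem XX_good (hf : Density f f' L R) (hL : 0 ≤ L) (hLR : L < R) (hR : R ≤ 1) (m : ℕ)
    (κ τ a b : ℝ) (hκ : κ ∈ Icc (0:ℝ) 1) (ha : a = κ * Pp f m τ) (hb : b = κ * Pm f m τ)
    (hba : b < a) :
    0 ≤ b / (a + b) ∧ b / (a + b) ≤ (1 - b) / (2 - a - b) ∧ (1 - b) / (2 - a - b) ≤ 1 ∧
    Feasible f L R (XX m (b / (a + b)) ((1 - b) / (2 - a - b)) κ τ) ∧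
    Value f L R (XX m (b / (a + b)) ((1 - b) / (2 - a - b)) κ τ) =
      MM f (b / (a + b)) ((1 - b) / (2 - a - b)) := by
  have hp := Pp_mem hf hL hLR hR m τ
  have hm := Pm_mem hf hL hLR hR m τ
  have b0 : 0 ≤ b := by rw [hb]; exact mul_nonneg hκ.1 hm.1
  have a1 : a ≤ 1 := by rw [ha]; exact mul_le_one₀ hκ.2 hp.1 hp.2
  have hD1 : 0 < a + b := by linarith
  have hD2 : 0 < 2 - a - b := by linarith
  have q0 : 0 ≤ b / (a + b) := by positivity
  have q12 : b / (a + b) ≤ (1 - b) / (2 - a - b) := by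
    rw [div_le_div_iff₀ hD1 hD2]; nlinarith
  have q1 : (1 - b) / (2 - a - b) ≤ 1 := by
    rw [div_le_one hD2]; linarith
  refine ⟨q0, q12, q1, ?_, ?_⟩
  · refine XX_feas hf hL hLR hR m _ _ κ τ a b hκ ha hb ?_ ?_ ?_
    · intro s hs
      rw [lt_div_iff₀ hD1] at hs
      constructor <;> nlinarith
    · intro s hs hs2
      rw [div_le_iff₀ hD1] at hs
      rw [lt_div_iff₀ hD2] at hs2
      constructor <;> nlinarith
    · intro s hs hs2
      rw [div_le_iff₀ hD2] at hs2
      constructor <;> nlinarith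
  · have hV : Value f L R (XX m (b / (a + b)) ((1 - b) / (2 - a - b)) κ τ) =
        ∫ s in L..R, (s * menu (b / (a + b)) ((1 - b) / (2 - a - b)) a s +
          (1 - s) * menu (b / (a + b)) ((1 - b) / (2 - a - b)) b s) * f s := by
      rw [Value, ← intervalIntegral.integral_const_mul, ha, hb]
      congr 1
      ext s
      rw [← XX_A hf hL hLR hR, ← XX_B hf hL hLR hR]
      ring
    rw [hV, menu_value hf hL hLR hR q0 q12 q1, MM, GG, GG]
    have i1 := fun p q => hf.ii (g := fun s => s) continuous_id p q
    have i2 := fun p q => hf.ii (g := fun s => 1 - s) (by fun_prop) p q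
    rw [← intervalIntegral.integral_add_adjacent_intervals
        (i1 (b / (a + b)) ((1 - b) / (2 - a - b))) (i1 _ 1),
      ← intervalIntegral.integral_add_adjacent_intervals
        (i2 (b / (a + b)) ((1 - b) / (2 - a - b))) (i2 _ 1)]
    generalize (∫ s in (b / (a + b))..((1 - b) / (2 - a - b)), s * f s) = F1
    generalize (∫ s in (b / (a + b))..((1 - b) / (2 - a - b)), (1 - s) * f s) = F0
    generalize (∫ s in ((1 - b) / (2 - a - b))..1, s * f s) = E1
    generalize (∫ s in ((1 - b) / (2 - a - b))..1, (1 - s) * f s) = E0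
    have hd : (1 - b) / (2 - a - b) - b / (a + b) = (a - b) / ((a + b) * (2 - a - b)) := by
      field_simp; ring
    have hab : a - b ≠ 0 := by linarith
    rw [hd]
    field_simp
    ring
end partD
section partE
variable {f f' : ℝ → ℝ} {L R : ℝ}

theorem approx (hf : Density f f' L R) (hL : 0 ≤ L) (hLR : L < R) (hR : R ≤ 1) {q1 q2 : ℝ}
    (h1 : q1 ∈ Ico (0:ℝ) (1/2)) (h2 : q2 ∈ Ioc (1/2:ℝ) 1) {ε : ℝ} (hε : 0 < ε) :
    ∀ᶠ m in atTop, ∃ smin smax κ τ : ℝ, 0 ≤ smin ∧ smin ≤ smax ∧ smax ≤ 1 ∧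
      κ ∈ Icc (0:ℝ) 1 ∧ 0 ≤ τ ∧ Feasible f L R (XX m smin smax κ τ) ∧
      MM f q1 q2 - ε < Value f L R (XX m smin smax κ τ) := by
  obtain ⟨h10, h11⟩ := h1
  obtain ⟨h20, h21⟩ := h2
  have d1 : 0 < 1 - q1 := by linarith
  have d2 : 0 < q2 - q1 := by linarith
  set κ := (2 * q2 - 1) * (1 - q1) / (q2 - q1) with hκ
  have κ0 : 0 < κ := by
    have : 0 < 2 * q2 - 1 := by linarith
    positivity
  have κ1 : κ ≤ 1 := by
    rw [hκ, div_le_one d2]; nlinarith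
  set β := q1 / (1 - q1) with hβ
  have β0 : 0 ≤ β := by positivity
  have β1 : β < 1 := by rw [hβ, div_lt_one d1]; linarith
  obtain ⟨τ, hτ, tp, tm⟩ := tests hf hL hLR hR (b := β) ⟨β0, β1.le⟩
  have ta : Tendsto (fun m => κ * Pp f m (τ m)) atTop (nhds κ) := by
    simpa using tp.const_mul κ
  have tb : Tendsto (fun m => κ * Pm f m (τ m)) atTop (nhds (κ * β)) := tm.const_mul κ
  have hlt : κ * β < κ := by nlinarith
  have e1 : κ * β / (κ + κ * β) = q1 := by
    rw [hβ]; field_simp; ring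
  have hDb : κ * β = (2 * q2 - 1) * q1 / (q2 - q1) := by
    rw [hκ, hβ]; field_simp
  have hD2 : 2 - κ - κ * β = (1 - 2 * q1) / (q2 - q1) := by
    rw [hDb, hκ]; field_simp; ring
  have hn : 1 - 2 * q1 ≠ 0 := by linarith
  have e2 : (1 - κ * β) / (2 - κ - κ * β) = q2 := by
    rw [hD2, hDb]; field_simp; ring
  have t1 : Tendsto (fun m => κ * Pm f m (τ m) / (κ * Pp f m (τ m) + κ * Pm f m (τ m))) atTop
      (nhds q1) := by
    have := tb.div (ta.add tb) (by positivity)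
    rwa [e1] at this
  have t2 : Tendsto (fun m => (1 - κ * Pm f m (τ m)) /
      (2 - κ * Pp f m (τ m) - κ * Pm f m (τ m))) atTop (nhds q2) := by
    have := (tb.const_sub 1).div ((ta.const_sub 2).sub tb)
      (by rw [hD2]; exact div_ne_zero hn d2.ne')
    rwa [e2] at this
  have g1 := (hf.GG_cont.tendsto q1).comp t1
  have g2 := (hf.GG_cont.tendsto q2).comp t2
  have tM := (((t2.sub_const (1/2)).mul g1).add ((t1.const_sub (1/2)).mul g2)).div (t2.sub t1) d2.ne'
  have tlt := tM.eventually_const_lt (show MM f q1 q2 - ε < _ by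
    change MM f q1 q2 - ε < MM f q1 q2
    linarith)
  filter_upwards [tb.eventually_lt ta hlt, tlt] with m hm hm2
  obtain ⟨r1, r2, r3, r4, r5⟩ := XX_good hf hL hLR hR m κ (τ m) _ _ ⟨κ0.le, κ1⟩ rfl rfl hm
  refine ⟨_, _, κ, τ m, r1, r2, r3, ⟨κ0.le, κ1⟩, hτ m, r4, ?_⟩
  rw [r5]
  exact hm2

theorem Feasible.value_le (hf : Density f f' L R) (hL : 0 ≤ L) (hLR : L < R) (hR : R ≤ 1) {m : ℕ}
    {x : ℝ → (Fin m → ℝ) → ℝ} (hx : Feasible f L R x) {α : ℝ}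
    (hα : ∀ q1 ∈ Ico (0:ℝ) (1/2), ∀ q2 ∈ Ioc (1/2:ℝ) 1,
      (q2 - 1/2) * GG f q1 + (1/2 - q1) * GG f q2 ≤ α * (q2 - q1)) :
    Value f L R x ≤ α := by
  obtain ⟨⟨-, hmem⟩, hIR, hIC⟩ := hx
  have hU : ∀ t s, Upay f x t s = s * (2 ^ m * Amap f x t) - (1 - s) * (2 ^ m * Bmap f x t) := by
    intro t s; rw [Upay]; ring
  have key := upper hL hLR hR hf (a := fun s => 2 ^ m * Amap f x s)
    (b := fun s => 2 ^ m * Bmap f x s)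
    (fun s _ => int_bounds (hf.wp_int m) (fun _ hy => wp_nonneg hf hy) (hmem s)
      (hf.wp_val hL hLR hR m))
    (fun s _ => int_bounds (hf.wm_int m) (fun _ hy => wm_nonneg hf hy) (hmem s)
      (hf.wm_val hL hLR hR m))
    (fun s hs => by simpa only [← hU] using hIR s hs)
    (fun s hs t ht => by simpa only [← hU] using hIC s hs t ht) hα
  refine le_of_eq_of_le ?_ key
  rw [Value, ← intervalIntegral.integral_const_mul]
  congr 1
  ext s
  ring
end partE

theorem stmt4 (L R : ℝ) (hL : 0 ≤ L) (hLR : L < R) (hR : R ≤ 1)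
    (f f' : ℝ → ℝ) (hf : Density f f' L R) :
    ∃ smin smax κ τ : ℕ → ℝ, ∃ X : (n : ℕ) → ℝ → (Fin (n - 1) → ℝ) → ℝ,
      (∀ n, 2 ≤ n →
        smin n ∈ Set.Icc (0:ℝ) 1 ∧ smax n ∈ Set.Icc (0:ℝ) 1 ∧ smin n ≤ smax n ∧
        κ n ∈ Set.Icc (0:ℝ) 1 ∧ 0 ≤ τ n ∧
        (∀ (s : ℝ) (y : Fin (n - 1) → ℝ),
          X n s y =
            if s < smin n then 0
            else if s < smax n then
              (if τ n * ∏ k, (1 - y k) ≤ ∏ k, y k then κ n else 0)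
            else 1) ∧
        Feasible f L R (X n)) ∧
      Filter.Tendsto
        (fun n : ℕ =>
          |sSup (Set.image (Value f L R (m := n - 1))
              {x : ℝ → (Fin (n - 1) → ℝ) → ℝ | Feasible f L R x}) -
            Value f L R (X n)|)
        Filter.atTop (nhds 0) := by
  -- the limit value
  set T : Set ℝ := {v | ∃ q1 ∈ Ico (0:ℝ) (1/2), ∃ q2 ∈ Ioc (1/2:ℝ) 1, v = MM f q1 q2} with hT
  have hTn : T.Nonempty := ⟨_, 0, ⟨le_rfl, by norm_num⟩, 1, ⟨by norm_num, le_rfl⟩, rfl⟩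
  have hTb : BddAbove T := by
    obtain ⟨B, hB⟩ := (isCompact_Icc (a := (0:ℝ)) (b := 1)).exists_bound_of_continuousOn
      hf.GG_cont.continuousOn
    refine ⟨B, ?_⟩
    rintro _ ⟨q1, h1, q2, h2, rfl⟩
    obtain ⟨h10, h11⟩ := h1
    obtain ⟨h20, h21⟩ := h2
    have b1 := (le_abs_self _).trans (hB q1 ⟨h10, by linarith⟩)
    have b2 := (le_abs_self _).trans (hB q2 ⟨by linarith, h21⟩)
    rw [MM, div_le_iff₀ (by linarith)]
    nlinarith
  set α := sSup T with hα
  have hαq : ∀ q1 ∈ Ico (0:ℝ) (1/2), ∀ q2 ∈ Ioc (1/2:ℝ) 1,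
      (q2 - 1/2) * GG f q1 + (1/2 - q1) * GG f q2 ≤ α * (q2 - q1) := by
    intro q1 h1 q2 h2
    have : MM f q1 q2 ≤ α := le_csSup hTb ⟨q1, h1, q2, h2, rfl⟩
    rwa [MM, div_le_iff₀ (by linarith [h1.2, h2.1])] at this
  have hup : ∀ (m : ℕ) (x : ℝ → (Fin m → ℝ) → ℝ), Feasible f L R x → Value f L R x ≤ α :=
    fun m x hx => hx.value_le hf hL hLR hR hαq
  -- parametric values
  let Q : ℕ → Set ℝ := fun m => {v | ∃ smin smax κ τ : ℝ, (0 ≤ smin ∧ smin ≤ smax ∧ smax ≤ 1 ∧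
      κ ∈ Icc (0:ℝ) 1 ∧ 0 ≤ τ ∧ Feasible f L R (XX m smin smax κ τ)) ∧
      v = Value f L R (XX m smin smax κ τ)}
  have hQn : ∀ m, (Q m).Nonempty := by
    intro m
    refine ⟨_, 1/2, 1/2, 0, 0, ⟨by norm_num, le_rfl, by norm_num, by simp, le_rfl, ?_⟩, rfl⟩
    refine XX_feas hf hL hLR hR m _ _ 0 0 0 0 (by simp) (by simp) (by simp) ?_ ?_ ?_
    · intro s hs; constructor <;> linarith
    · intro s hs hs2; linarith
    · intro s hs hs2; constructor <;> linarith
  have hQb : ∀ m, BddAbove (Q m) := by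
    intro m
    refine ⟨α, ?_⟩
    rintro _ ⟨_, _, _, _, ⟨-, -, -, -, -, h⟩, rfl⟩
    exact hup m _ h
  have hch : ∀ n : ℕ, ∃ smin smax κ τ : ℝ, (0 ≤ smin ∧ smin ≤ smax ∧ smax ≤ 1 ∧
      κ ∈ Icc (0:ℝ) 1 ∧ 0 ≤ τ ∧ Feasible f L R (XX (n - 1) smin smax κ τ)) ∧
      sSup (Q (n - 1)) - 1 / ((n:ℝ) + 1) < Value f L R (XX (n - 1) smin smax κ τ) := by
    intro n
    have hpos : (0:ℝ) < 1 / ((n:ℝ) + 1) := by positivity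
    obtain ⟨v, ⟨a, b, c, d, h, rfl⟩, hv⟩ :=
      exists_lt_of_lt_csSup (hQn (n - 1)) (sub_lt_self (sSup (Q (n - 1))) hpos)
    exact ⟨a, b, c, d, h, hv⟩
  choose smin smax κ τ hP hval using hch
  refine ⟨smin, smax, κ, τ, fun n => XX (n - 1) (smin n) (smax n) (κ n) (τ n), ?_, ?_⟩
  · intro n _
    obtain ⟨p1, p2, p3, p4, p5, p6⟩ := hP n
    exact ⟨⟨p1, p2.trans p3⟩, ⟨p1.trans p2, p3⟩, p2, p4, p5, fun s y => rfl, p6⟩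
  · have hlow : ∀ ε > 0, ∀ᶠ m in atTop, α - ε < sSup (Q m) := by
      intro ε hε
      obtain ⟨v, ⟨q1, h1, q2, h2, rfl⟩, hv⟩ :=
        exists_lt_of_lt_csSup hTn (sub_lt_self (sSup T) (half_pos hε))
      filter_upwards [approx hf hL hLR hR h1 h2 (half_pos hε)] with m hm
      obtain ⟨a, b, c, d, r1, r2, r3, r4, r5, r6, r7⟩ := hm
      have : Value f L R (XX m a b c d) ≤ sSup (Q m) :=
        le_csSup (hQb m) ⟨a, b, c, d, ⟨r1, r2, r3, r4, r5, r6⟩, rfl⟩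
      linarith
    have ht1 : Tendsto (fun n : ℕ => 1 / ((n:ℝ) + 1)) atTop (nhds 0) :=
      tendsto_one_div_add_atTop_nhds_zero_nat
    rw [Metric.tendsto_nhds]
    intro ε hε
    have hlow2 := (tendsto_sub_atTop_nat 1).eventually (hlow (ε / 2) (half_pos hε))
    filter_upwards [hlow2, ht1.eventually_lt_const (half_pos hε)] with n h1 h2
    have hv := hval n
    set V := sSup (Set.image (Value f L R (m := n - 1))
              {x : ℝ → (Fin (n - 1) → ℝ) → ℝ | Feasible f L R x}) with hV
    have hmem := mem_image_of_mem (Value f L R (m := n - 1)) (show XX (n - 1) (smin n) (smax n)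
      (κ n) (τ n) ∈ {x : ℝ → (Fin (n - 1) → ℝ) → ℝ | Feasible f L R x} from (hP n).2.2.2.2.2)
    have hb : ∀ v ∈ Set.image (Value f L R (m := n - 1))
              {x : ℝ → (Fin (n - 1) → ℝ) → ℝ | Feasible f L R x}, v ≤ α := by
      rintro _ ⟨x, hx, rfl⟩
      exact hup _ x hx
    have hV1 : V ≤ α := csSup_le ⟨_, hmem⟩ hb
    have hV2 := le_csSup ⟨α, hb⟩ hmem
    rw [Real.dist_eq, sub_zero, abs_abs, abs_of_nonneg (sub_nonneg.2 hV2)]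
    linarith
end
end

section
/- A mechanism x is feasible if and only if the following three conditions hold: (M) the interim allocation X is monotone nondecreasing on [L,R]; (EV) for every s ∈ [L,R], ∫_L^s X(t) dt = (s·A(s) − (1−s)·B(s)) − (L·A(L) − (1−L)·B(L)); and (P0) L·A(L) − (1−L)·B(L) ≥ 0. -/
open MeasureTheory Set Filter

noncomputable section

theorem aux_const (g X : ℝ → ℝ) (a b : ℝ) (hab : a ≤ b)
    (h : ∀ t s, a ≤ t → t ≤ s → s ≤ b → |g s - g t| ≤ (s - t) * (X s - X t)) : g b = g a := by
  have key : ∀ N : ℕ, 0 < N → |g b - g a| ≤ (b - a) / N * (X b - X a) := by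
    intro N hN
    have hN' : (0:ℝ) < N := by exact_mod_cast hN
    set d := (b - a) / N with hd
    have hd0 : 0 ≤ d := div_nonneg (by linarith) hN'.le
    have hNd : (N:ℝ) * d = b - a := by rw [hd]; field_simp
    have ind : ∀ k : ℕ, k ≤ N → |g (a + k * d) - g a| ≤ d * (X (a + k * d) - X a) := by
      intro k
      induction k with
      | zero => intro _; simp
      | succ k ih =>
        intro hk
        have h1 := ih (by omega)
        have hk' : ((k + 1 : ℕ) : ℝ) ≤ N := by exact_mod_cast hk
        have h3 : ((k + 1 : ℕ) : ℝ) * d ≤ b - a := by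
          rw [← hNd]; exact mul_le_mul_of_nonneg_right hk' hd0
        have e : ((k + 1 : ℕ) : ℝ) * d = k * d + d := by push_cast; ring
        have h4 : 0 ≤ (k:ℝ) * d := by positivity
        have h2 := h (a + k * d) (a + (k + 1 : ℕ) * d) (by linarith) (by linarith) (by linarith)
        have e2 : (a + (k + 1 : ℕ) * d) - (a + k * d) = d := by rw [e]; ring
        rw [e2] at h2
        have h5 := abs_sub_le (g (a + (k + 1 : ℕ) * d)) (g (a + k * d)) (g a)
        linarith
    have := ind N le_rfl
    rwa [hNd, add_sub_cancel] at this
  have lim : Tendsto (fun N : ℕ => (b - a) / (N:ℝ) * (X b - X a)) atTop (nhds 0) := by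
    have := (tendsto_const_div_atTop_nhds_zero_nat (b - a)).mul_const (X b - X a)
    simpa using this
  have : |g b - g a| ≤ 0 :=
    ge_of_tendsto lim (by filter_upwards [eventually_gt_atTop 0] with N hN using key N hN)
  have := abs_nonpos_iff.mp this
  linarith

theorem aux_int (X : ℝ → ℝ) (L R : ℝ) (hX : MonotoneOn X (Set.Icc L R)) (t s : ℝ)
    (ht : L ≤ t) (hts : t ≤ s) (hs : s ≤ R) :
    IntervalIntegrable X volume t s ∧ (s - t) * X t ≤ ∫ r in t..s, X r ∧
      ∫ r in t..s, X r ≤ (s - t) * X s := by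
  have hi : IntervalIntegrable X volume t s := by
    apply MonotoneOn.intervalIntegrable
    rw [uIcc_of_le hts]
    exact hX.mono (Icc_subset_Icc ht hs)
  refine ⟨hi, ?_, ?_⟩
  · have := intervalIntegral.integral_mono_on (f := fun _ => X t) hts (by simp) hi
      (fun r hr => hX ⟨ht, hts.trans hs⟩ ⟨ht.trans hr.1, hr.2.trans hs⟩ hr.1)
    simpa using this
  · have := intervalIntegral.integral_mono_on (g := fun _ => X s) hts hi (by simp)
      (fun r hr => hX ⟨ht.trans hr.1, hr.2.trans hs⟩ ⟨ht.trans hts, hs⟩ hr.2)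
    simpa using this

theorem stmt5 (n : ℕ) (hn : 2 ≤ n) (L R : ℝ) (hL : 0 ≤ L) (hLR : L < R) (hR : R ≤ 1)
    (f f' : ℝ → ℝ) (hf : Density f f' L R)
    (x : ℝ → (Fin (n - 1) → ℝ) → ℝ) (hx : IsMechanism x) :
    Feasible f L R x ↔
      (MonotoneOn (fun s => Amap f x s + Bmap f x s) (Set.Icc L R) ∧
        (∀ s ∈ Set.Icc L R,
          (∫ t in L..s, (Amap f x t + Bmap f x t)) =
            (s * Amap f x s - (1 - s) * Bmap f x s) -
              (L * Amap f x L - (1 - L) * Bmap f x L)) ∧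
        0 ≤ L * Amap f x L - (1 - L) * Bmap f x L) := by
  have hmc : MeasurableSet (cube (n - 1)) := MeasurableSet.univ_pi fun _ => measurableSet_Icc
  have hA : ∀ t, 0 ≤ Amap f x t := fun t => setIntegral_nonneg hmc fun y hy =>
    mul_nonneg (hx.2 t y).1 (Finset.prod_nonneg fun k _ =>
      mul_nonneg (hy k (mem_univ k)).1 (hf.nonneg _))
  have hB : ∀ t, 0 ≤ Bmap f x t := fun t => setIntegral_nonneg hmc fun y hy =>
    mul_nonneg (hx.2 t y).1 (Finset.prod_nonneg fun k _ =>
      mul_nonneg (sub_nonneg.2 (hy k (mem_univ k)).2) (hf.nonneg _))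
  have h2 : (0:ℝ) < 2 ^ (n - 1) := by positivity
  have hfe : Feasible f L R x ↔
      (∀ s ∈ Set.Icc L R, 0 ≤ s * Amap f x s - (1 - s) * Bmap f x s) ∧
      (∀ s ∈ Set.Icc L R, ∀ t ∈ Set.Icc L R, s * Amap f x t - (1 - s) * Bmap f x t ≤
        s * Amap f x s - (1 - s) * Bmap f x s) := by
    unfold Feasible Upay
    simp only [mul_le_mul_iff_right₀ h2, mul_nonneg_iff_of_pos_left h2, hx, true_and]
  rw [hfe]
  generalize Amap f x = A at *
  generalize Bmap f x = B at *
  constructor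
  · rintro ⟨hP, hIC⟩
    have hM : MonotoneOn (fun s => A s + B s) (Set.Icc L R) := by
      intro t ht s hs hts
      rcases hts.eq_or_lt with rfl | hlt
      · exact le_rfl
      have h1 := hIC s hs t ht
      have h3 := hIC t ht s hs
      have : (s - t) * (A t + B t) ≤ (s - t) * (A s + B s) := by nlinarith
      exact le_of_mul_le_mul_left this (by linarith)
    refine ⟨hM, ?_, hP L ⟨le_rfl, hLR.le⟩⟩
    intro s hs
    have := aux_const (fun s => (s * A s - (1 - s) * B s) - ∫ t in L..s, (A t + B t))
      (fun s => A s + B s) L s hs.1 (by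
        intro t r ht htr hr
        have hrR := hr.trans hs.2
        obtain ⟨i1, i2, i3⟩ := aux_int _ L R hM t r ht htr hrR
        obtain ⟨j1, -, -⟩ := aux_int _ L R hM L t le_rfl ht (htr.trans hrR)
        have hadd := intervalIntegral.integral_add_adjacent_intervals j1 i1
        have h1 := hIC r ⟨ht.trans htr, hrR⟩ t ⟨ht, htr.trans hrR⟩
        have h3 := hIC t ⟨ht, htr.trans hrR⟩ r ⟨ht.trans htr, hrR⟩
        rw [← hadd, abs_le]
        constructor <;> nlinarith)
    simp only [intervalIntegral.integral_same] at this
    linarith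
  · rintro ⟨hM, hEV, hP⟩
    have hd : ∀ t s, L ≤ t → t ≤ s → s ≤ R → 
        (s - t) * (A t + B t) ≤ (s * A s - (1 - s) * B s) - (t * A t - (1 - t) * B t) ∧
        (s * A s - (1 - s) * B s) - (t * A t - (1 - t) * B t) ≤ (s - t) * (A s + B s) := by
      intro t s ht hts hs
      obtain ⟨i1, i2, i3⟩ := aux_int _ L R hM t s ht hts hs
      obtain ⟨j1, -, -⟩ := aux_int _ L R hM L t le_rfl ht (hts.trans hs)
      have hadd := intervalIntegral.integral_add_adjacent_intervals j1 i1
      have e1 := hEV t ⟨ht, hts.trans hs⟩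
      have e2 := hEV s ⟨ht.trans hts, hs⟩
      constructor <;> linarith
    constructor
    · intro s hs
      have h1 := (hd L s le_rfl hs.1 hs.2).1
      have h3 : 0 ≤ (s - L) * (A L + B L) :=
        mul_nonneg (sub_nonneg.2 hs.1) (add_nonneg (hA L) (hB L))
      linarith
    · intro s hs t ht
      rcases le_total t s with h | h
      · have := (hd t s ht.1 h hs.2).1
        nlinarith
      · have := (hd s t hs.1 h ht.2).2
        nlinarith
end
end

section
/- If x is a feasible mechanism, then there exists a function Ũ : [0,1] → ℝ such that Ũ(s) = U_x(s) for all s ∈ [L,R], Ũ is monotone nondecreasing and convex on [0,1], Ũ is Lipschitz with constant 2, and 0 ≤ Ũ(s) ≤ Ubar(s) for all s ∈ [0,1]. -/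
open MeasureTheory Set Filter

noncomputable section

theorem prod_aux (m : ℕ) (L R : ℝ) (hL : 0 ≤ L) (hLR : L < R) (hR : R ≤ 1) (g : ℝ → ℝ)
    (hg : ContinuousOn g (Set.Icc L R)) (h0 : ∀ s ∉ Set.Icc L R, g s = 0)
    (hi : ∫ s in L..R, g s = 1 / 2) :
    IntegrableOn (fun y : Fin m → ℝ => ∏ k, g (y k)) (cube m) ∧
      ∫ y in cube m, ∏ k, g (y k) = (1 / 2) ^ m := by
  have hsub : Set.Icc L R ⊆ Set.Icc (0:ℝ) 1 := Set.Icc_subset_Icc hL hR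
  have h1 : IntegrableOn g (Set.Icc L R) := hg.integrableOn_Icc
  have h2 : IntegrableOn g (Set.Icc (0:ℝ) 1) :=
    h1.of_forall_sdiff_eq_zero measurableSet_Icc (fun s hs => h0 s hs.2)
  have h3 : ∫ s in Set.Icc (0:ℝ) 1, g s = 1 / 2 := by
    rw [setIntegral_eq_of_subset_of_forall_sdiff_eq_zero measurableSet_Icc hsub
      (fun s hs => h0 s hs.2), integral_Icc_eq_integral_Ioc,
      ← intervalIntegral.integral_of_le hLR.le, hi]
  have hr : (volume : Measure (Fin m → ℝ)).restrict (cube m)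
      = Measure.pi (fun _ => (volume : Measure ℝ).restrict (Set.Icc 0 1)) := by
    rw [cube, volume_pi, Measure.restrict_pi_pi]
  constructor
  · rw [IntegrableOn, hr]
    exact Integrable.fintype_prod (f := fun _ => g) (fun _ => h2)
  · rw [hr, integral_fintype_prod_eq_prod (fun _ => g)]
    simp only [h3, Finset.prod_const, Finset.card_univ, Fintype.card_fin]

theorem weighted_aux {m : ℕ} (z w : (Fin m → ℝ) → ℝ) (hz : Measurable z)
    (hz1 : ∀ y, z y ∈ Set.Icc (0:ℝ) 1) (hw : IntegrableOn w (cube m))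
    (hw0 : ∀ y ∈ cube m, 0 ≤ w y) :
    IntegrableOn (fun y => z y * w y) (cube m) ∧ 0 ≤ ∫ y in cube m, z y * w y ∧
      ∫ y in cube m, z y * w y ≤ ∫ y in cube m, w y := by
  have hc : MeasurableSet (cube m) := MeasurableSet.univ_pi fun _ => measurableSet_Icc
  have hi : IntegrableOn (fun y => z y * w y) (cube m) := by
    refine Integrable.bdd_mul (c := 1) hw hz.aestronglyMeasurable ?_
    refine Eventually.of_forall fun y => ?_
    rw [Real.norm_eq_abs, abs_of_nonneg (hz1 y).1]
    exact (hz1 y).2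
  refine ⟨hi, setIntegral_nonneg hc fun y hy => mul_nonneg (hz1 y).1 (hw0 y hy),
    setIntegral_mono_on hi hw hc fun y hy => ?_⟩
  exact mul_le_of_le_one_left (hw0 y hy) (hz1 y).2

theorem sup_aux {ι : Type} [Nonempty ι] (p q : ι → ℝ) (V : ℝ → ℝ)
    (hp : ∀ i, 0 ≤ p i ∧ p i ≤ 1) (hq : ∀ i, 0 ≤ q i ∧ q i ≤ 1)
    (hV : ∀ s ∈ Set.Icc (0:ℝ) 1, ∀ i, max (s * p i - (1 - s) * q i) 0 ≤ V s) (U : ℝ → ℝ)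
    (hU : ∀ s, U s = ⨆ i, max (s * p i - (1 - s) * q i) 0) :
      MonotoneOn U (Set.Icc (0:ℝ) 1) ∧
      ConvexOn ℝ (Set.Icc (0:ℝ) 1) U ∧
      LipschitzOnWith 2 U (Set.Icc (0:ℝ) 1) ∧
      (∀ s ∈ Set.Icc (0:ℝ) 1, 0 ≤ U s ∧ U s ≤ V s) := by
  have hle : ∀ s ∈ Set.Icc (0:ℝ) 1, ∀ i, s * p i - (1 - s) * q i ≤ U s ∧ 0 ≤ U s := by
    intro s hs i
    rw [← max_le_iff, hU]
    exact le_ciSup (f := fun i => max (s * p i - (1 - s) * q i) 0)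
      ⟨V s, by rintro _ ⟨j, rfl⟩; exact hV s hs j⟩ i
  have hs0 : ∀ s ∈ Set.Icc (0:ℝ) 1, 0 ≤ U s := fun s hs => (hle s hs (Classical.arbitrary ι)).2
  have hub : ∀ s c, 0 ≤ c → (∀ i, s * p i - (1 - s) * q i ≤ c) → U s ≤ c := by
    intro s c hc h
    rw [hU]
    exact ciSup_le fun i => max_le (h i) hc
  refine ⟨?_, ⟨convex_Icc _ _, ?_⟩, ?_, ?_⟩
  · intro s hs t ht hst
    refine hub _ _ (hs0 t ht) fun i => ?_
    have := (hle t ht i).1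
    nlinarith [mul_nonneg (sub_nonneg.2 hst) (add_nonneg (hp i).1 (hq i).1)]
  · intro s hs t ht a b ha hb hab
    simp only [smul_eq_mul]
    refine hub _ _ (add_nonneg (mul_nonneg ha (hs0 s hs)) (mul_nonneg hb (hs0 t ht)))
      fun i => ?_
    have e : (a * s + b * t) * p i - (1 - (a * s + b * t)) * q i
        = a * (s * p i - (1 - s) * q i) + b * (t * p i - (1 - t) * q i) := by
      obtain rfl : b = 1 - a := by linarith
      ring
    rw [e]
    exact add_le_add (mul_le_mul_of_nonneg_left (hle s hs i).1 ha)
      (mul_le_mul_of_nonneg_left (hle t ht i).1 hb)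
  · refine LipschitzOnWith.of_le_add_mul 2 fun s hs t ht => ?_
    have h2 : ((2 : NNReal) : ℝ) = 2 := rfl
    rw [h2, Real.dist_eq]
    have habs := abs_nonneg (s - t)
    refine hub _ _ (by linarith [hs0 t ht]) fun i => ?_
    have := (hle t ht i).1
    have h3 : (s - t) * (p i + q i) ≤ |s - t| * 2 :=
      mul_le_mul (le_abs_self _) (by linarith [(hp i).2, (hq i).2])
        (add_nonneg (hp i).1 (hq i).1) habs
    nlinarith
  · intro s hs
    refine ⟨hs0 s hs, ?_⟩
    rw [hU]
    exact ciSup_le (hV s hs)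

theorem stmt6 (n : ℕ) (hn : 2 ≤ n) (L R : ℝ) (hL : 0 ≤ L) (hLR : L < R) (hR : R ≤ 1)
    (f f' : ℝ → ℝ) (hf : Density f f' L R)
    (x : ℝ → (Fin (n - 1) → ℝ) → ℝ) (hx : Feasible f L R x) :
    ∃ Ut : ℝ → ℝ,
      (∀ s ∈ Set.Icc L R, Ut s = Upay f x s s) ∧
      MonotoneOn Ut (Set.Icc (0:ℝ) 1) ∧
      ConvexOn ℝ (Set.Icc (0:ℝ) 1) Ut ∧
      LipschitzOnWith 2 Ut (Set.Icc (0:ℝ) 1) ∧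
      (∀ s ∈ Set.Icc (0:ℝ) 1, 0 ≤ Ut s ∧ Ut s ≤ Ubar f (n - 1) s) := by
  obtain ⟨⟨hxm, hx1⟩, hpart, hic⟩ := hx
  have hfc : ContinuousOn f (Set.Icc L R) := fun s hs => (hf.hderiv s hs).continuousWithinAt
  have hfi : IntervalIntegrable f volume L R := hfc.intervalIntegrable_of_Icc hLR.le
  have hsfc : ContinuousOn (fun s => s * f s) (Set.Icc L R) := continuousOn_id.mul hfc
  have hsfi : IntervalIntegrable (fun s => s * f s) volume L R :=
    hsfc.intervalIntegrable_of_Icc hLR.le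
  have hP := prod_aux (n - 1) L R hL hLR hR (fun s => s * f s) hsfc
    (fun s hs => by simp [hf.zero_outside s hs]) hf.mean
  have hQ := prod_aux (n - 1) L R hL hLR hR (fun s => (1 - s) * f s)
    ((continuousOn_const.sub continuousOn_id).mul hfc)
    (fun s hs => by simp [hf.zero_outside s hs]) (by
      have : (fun s => (1 - s) * f s) = fun s => f s - s * f s := by
        funext s; ring
      rw [this, intervalIntegral.integral_sub hfi hsfi, hf.total, hf.mean]
      norm_num)
  change IntegrableOn (wplus f) _ ∧ ∫ y in cube (n-1), wplus f y = _ at hP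
  change IntegrableOn (wminus f) _ ∧ ∫ y in cube (n-1), wminus f y = _ at hQ
  have hw0 : ∀ y ∈ cube (n-1), 0 ≤ wplus f y := fun y hy =>
    Finset.prod_nonneg fun k _ => mul_nonneg (hy k (Set.mem_univ k)).1 (hf.nonneg _)
  have hv0 : ∀ y ∈ cube (n-1), 0 ≤ wminus f y := fun y hy =>
    Finset.prod_nonneg fun k _ =>
      mul_nonneg (sub_nonneg.2 (hy k (Set.mem_univ k)).2) (hf.nonneg _)
  have hxt : ∀ t, Measurable (x t) := fun t => hxm.comp measurable_prodMk_left
  have hA := fun t => weighted_aux (x t) (wplus f) (hxt t) (hx1 t) hP.1 hw0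
  have hB := fun t => weighted_aux (x t) (wminus f) (hxt t) (hx1 t) hQ.1 hv0
  have hc : MeasurableSet (cube (n-1)) := MeasurableSet.univ_pi fun _ => measurableSet_Icc
  have h2 : (0:ℝ) < 2 ^ (n-1) := by positivity
  have h22 : (2:ℝ) ^ (n-1) * (1/2) ^ (n-1) = 1 := by
    rw [← mul_pow]; norm_num
  have hVint : ∀ s : ℝ, IntegrableOn (fun y => max (s * wplus f y - (1 - s) * wminus f y) 0)
      (cube (n-1)) := fun s => ((hP.1.const_mul s).sub (hQ.1.const_mul (1 - s))).pos_part
  have hV : ∀ s t, max (Upay f x t s) 0 ≤ Ubar f (n-1) s := by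
    intro s t
    refine max_le ?_ ?_
    · refine mul_le_mul_of_nonneg_left ?_ h2.le
      rw [Amap, Bmap, ← integral_const_mul, ← integral_const_mul,
        ← integral_sub ((hA t).1.const_mul s) ((hB t).1.const_mul (1 - s))]
      refine setIntegral_mono_on (((hA t).1.const_mul s).sub ((hB t).1.const_mul (1 - s)))
        (hVint s) hc fun y hy => ?_
      have e : s * (x t y * wplus f y) - (1 - s) * (x t y * wminus f y)
          = x t y * (s * wplus f y - (1 - s) * wminus f y) := by ring
      simp only [e]
      calc _ ≤ x t y * max (s * wplus f y - (1 - s) * wminus f y) 0 :=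
            mul_le_mul_of_nonneg_left (le_max_left _ _) (hx1 t y).1
        _ ≤ _ := mul_le_of_le_one_left (le_max_right _ _) (hx1 t y).2
    · exact mul_nonneg h2.le (integral_nonneg fun y => le_max_right _ _)
  have hU : ∀ t s, Upay f x t s
      = s * (2 ^ (n-1) * Amap f x t) - (1 - s) * (2 ^ (n-1) * Bmap f x t) := by
    intro t s; rw [Upay]; ring
  have : Nonempty (Set.Icc L R) := ⟨⟨L, le_rfl, hLR.le⟩⟩
  refine ⟨fun s => ⨆ t : Set.Icc L R, max (Upay f x t s) 0, ?_, ?_⟩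
  · intro s hs
    refine le_antisymm (ciSup_le fun t => max_le (hic s hs t t.2) (hpart s hs)) ?_
    exact (le_max_left _ _).trans (le_ciSup (f := fun t : Set.Icc L R => max (Upay f x t s) 0)
      ⟨Ubar f (n-1) s, by rintro _ ⟨j, rfl⟩; exact hV s j⟩ ⟨s, hs⟩)
  · refine sup_aux (ι := Set.Icc L R) (fun t => 2 ^ (n-1) * Amap f x t)
      (fun t => 2 ^ (n-1) * Bmap f x t) (Ubar f (n-1)) ?_ ?_ ?_ _ ?_
    · intro t
      refine ⟨mul_nonneg h2.le (hA t).2.1, ?_⟩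
      rw [← h22, ← hP.2]
      exact mul_le_mul_of_nonneg_left (hA t).2.2 h2.le
    · intro t
      refine ⟨mul_nonneg h2.le (hB t).2.1, ?_⟩
      rw [← h22, ← hQ.2]
      exact mul_le_mul_of_nonneg_left (hB t).2.2 h2.le
    · intro s _ t
      rw [← hU]
      exact hV s t
    · intro s
      simp only [hU]
end
end

section
/- For every feasible mechanism x, V(x) = −∫_L^R (3·(1−2s)·f(s) + 2·s·(1−s)·f'(s))·U_x(s) ds + 2·R·(1−R)·f(R)·U_x(R) − 2·L·(1−L)·f(L)·U_x(L). -/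
open MeasureTheory Set Filter

noncomputable section

lemma aux_U (L R : ℝ) (hLR : L < R) (U g : ℝ → ℝ)
    (h : ∀ s ∈ Set.Icc L R, ∀ t ∈ Set.Icc L R, (s - t) * g t ≤ U s - U t) :
    MonotoneOn g (Set.Icc L R) ∧ ContinuousOn U (Set.Icc L R) ∧
    ∃ S : Set ℝ, S.Countable ∧ ∀ s ∈ Set.Ioo L R \ S, HasDerivAt U (g s) s := by
  have hmono : MonotoneOn g (Set.Icc L R) := by
    intro a ha b hb hab
    rcases hab.eq_or_lt with e | hlt
    · rw [e]
    have h1 := h a ha b hb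
    have h2 := h b hb a ha
    nlinarith
  have hcont : ContinuousOn U (Set.Icc L R) := by
    intro t ht
    have hLm : L ∈ Set.Icc L R := ⟨le_rfl, hLR.le⟩
    have hRm : R ∈ Set.Icc L R := ⟨hLR.le, le_rfl⟩
    have key : ∀ s ∈ Set.Icc L R, |U s - U t| ≤ (|g L| + |g R|) * |s - t| := by
      intro s hs
      have bd : ∀ r ∈ Set.Icc L R, |g r| ≤ |g L| + |g R| := by
        intro r hr
        have h1 := hmono hLm hr hr.1
        have h2 := hmono hr hRm hr.2
        rw [abs_le]
        constructor
        · linarith [neg_abs_le (g L), abs_nonneg (g R)]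
        · linarith [le_abs_self (g R), abs_nonneg (g L)]
      have e1 : |(s - t) * g t| ≤ (|g L| + |g R|) * |s - t| := by
        rw [abs_mul, mul_comm]
        exact mul_le_mul_of_nonneg_right (bd t ht) (abs_nonneg _)
      have e2 : |(t - s) * g s| ≤ (|g L| + |g R|) * |s - t| := by
        rw [abs_mul, mul_comm, abs_sub_comm t s]
        exact mul_le_mul_of_nonneg_right (bd s hs) (abs_nonneg _)
      have h1 := h s hs t ht
      have h2 := h t ht s hs
      rw [abs_le] at e1 e2 ⊢
      constructor <;> linarith [e1.1, e1.2, e2.1, e2.2]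
    rw [ContinuousWithinAt, tendsto_iff_norm_sub_tendsto_zero]
    refine squeeze_zero' (g := fun s => (|g L| + |g R|) * |s - t|)
      (Eventually.of_forall fun _ => norm_nonneg _) ?_ ?_
    · filter_upwards [self_mem_nhdsWithin] with s hs
      exact key s hs
    · have : ContinuousAt (fun s => (|g L| + |g R|) * |s - t|) t := by fun_prop
      have h3 := this.tendsto
      simp only [sub_self, abs_zero, mul_zero] at h3
      exact h3.mono_left nhdsWithin_le_nhds
  refine ⟨hmono, hcont, {x ∈ Set.Icc L R | ¬ ContinuousWithinAt g (Set.Icc L R) x},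
    hmono.countable_not_continuousWithinAt, ?_⟩
  rintro t ⟨ht, hnt⟩
  have htm : t ∈ Set.Icc L R := Ioo_subset_Icc_self ht
  have hnh : Set.Icc L R ∈ nhds t := Icc_mem_nhds ht.1 ht.2
  have hc : ContinuousAt g t := by
    by_contra hcon
    exact hnt ⟨htm, fun hw => hcon (hw.continuousAt hnh)⟩
  rw [hasDerivAt_iff_isLittleO, Asymptotics.isLittleO_iff]
  intro c hcpos
  have hev := Metric.continuousAt_iff'.1 hc c hcpos
  filter_upwards [hev, hnh] with s hs hsm
  have h1 := h s hsm t htm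
  have h2 := h t htm s hsm
  have h3 : |(s - t) * (g s - g t)| ≤ c * |s - t| := by
    rw [abs_mul, mul_comm]
    exact mul_le_mul_of_nonneg_right (by rw [Real.dist_eq] at hs; exact hs.le) (abs_nonneg _)
  rw [smul_eq_mul, Real.norm_eq_abs, Real.norm_eq_abs]
  rw [abs_le] at h3 ⊢
  have : 0 ≤ c * |s - t| := by positivity
  constructor <;> linarith [h3.1, h3.2]

theorem stmt8 (n : ℕ) (hn : 2 ≤ n) (L R : ℝ) (hL : 0 ≤ L) (hLR : L < R) (hR : R ≤ 1)
    (f f' : ℝ → ℝ) (hf : Density f f' L R)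
    (x : ℝ → (Fin (n - 1) → ℝ) → ℝ) (hx : Feasible f L R x) :
    Value f L R x =
      -(∫ s in L..R, (3 * (1 - 2 * s) * f s + 2 * s * (1 - s) * f' s) * Upay f x s s) +
        2 * R * (1 - R) * f R * Upay f x R R - 2 * L * (1 - L) * f L * Upay f x L L := by
  obtain ⟨-, -, hic⟩ := hx
  set U : ℝ → ℝ := fun s => Upay f x s s with hU
  set g : ℝ → ℝ := fun s => 2 ^ (n - 1) * (Amap f x s + Bmap f x s) with hg
  have hsub : ∀ s ∈ Set.Icc L R, ∀ t ∈ Set.Icc L R, (s - t) * g t ≤ U s - U t := by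
    intro s hs t ht
    have h1 := hic s hs t ht
    have h2 : Upay f x t s - Upay f x t t = (s - t) * g t := by
      simp only [Upay, hg]; ring
    simp only [hU]
    linarith
  obtain ⟨hmono, hUc, S, hS, hUd⟩ := aux_U L R hLR U g hsub
  have hfc : ContinuousOn f (Set.Icc L R) := fun s hs => (hf.hderiv s hs).continuousWithinAt
  have hf'c := hf.cont_deriv
  have hgi : IntervalIntegrable g volume L R := by
    apply MonotoneOn.intervalIntegrable
    rwa [uIcc_of_le hLR.le]
  have hI1 : IntervalIntegrable (fun s => (2 * (1 - 2 * s) * f s + 2 * s * (1 - s) * f' s) * U s)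
      volume L R := by
    apply ContinuousOn.intervalIntegrable
    rw [uIcc_of_le hLR.le]
    fun_prop
  have hI2 : IntervalIntegrable (fun s => (2 * s * (1 - s) * f s) * g s) volume L R := by
    apply hgi.continuousOn_mul
    rw [uIcc_of_le hLR.le]
    fun_prop
  have hI3 : IntervalIntegrable (fun s => (3 * (1 - 2 * s) * f s + 2 * s * (1 - s) * f' s) * U s)
      volume L R := by
    apply ContinuousOn.intervalIntegrable
    rw [uIcc_of_le hLR.le]
    fun_prop
  have hFTC := MeasureTheory.integral_eq_of_hasDerivAt_off_countable_of_le
    (fun s => (2 * s * (1 - s) * f s) * U s)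
    (fun s => (2 * (1 - 2 * s) * f s + 2 * s * (1 - s) * f' s) * U s
      + (2 * s * (1 - s) * f s) * g s) hLR.le hS (by fun_prop) (by
      intro s hs
      have d1 := hUd s hs
      have d2 := (hf.hderiv s (Ioo_subset_Icc_self hs.1)).hasDerivAt (Icc_mem_nhds hs.1.1 hs.1.2)
      have d3 : HasDerivAt (fun s : ℝ => 2 * s * (1 - s)) (2 * (1 - 2 * s)) s := by
        have := ((hasDerivAt_id' s).const_mul 2).mul ((hasDerivAt_id' s).const_sub 1)
        exact this.congr_deriv (by ring)
      exact (d3.mul d2).mul d1) (hI1.add hI2)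
  have hV : Value f L R x = ∫ s in L..R,
      (((2 * (1 - 2 * s) * f s + 2 * s * (1 - s) * f' s) * U s + (2 * s * (1 - s) * f s) * g s)
        - (3 * (1 - 2 * s) * f s + 2 * s * (1 - s) * f' s) * U s) := by
    rw [Value, ← intervalIntegral.integral_const_mul]
    congr 1
    funext s
    simp only [hU, hg, Upay]
    ring
  rw [hV, intervalIntegral.integral_sub (hI1.add hI2) hI3, hFTC]
  ring
end
end

section
/- Let a ∈ [0,2] and b ≥ 0 be such that a·s − b ≤ Ubar(s) for every s ∈ [0,1], and a·s₀ − b > max(0, 2s₀ − 1) for some s₀ ∈ [0,1]. Then there exist κ ∈ [0,1] and τ ≥ 0 such that 2^(n−1)·κ·∫_{[0,1]^(n−1)} (w⁺(y) + w⁻(y))·1{∏_{k=1}^{n−1} y_k ≥ τ·∏(1−y_k)} dy = a and 2^(n−1)·κ·∫_{[0,1]^(n−1)} w⁻(y)·1{∏_{k=1}^{n−1} y_k ≥ τ·∏(1−y_k)} dy = b. Moreover, if a·s₁ − b = Ubar(s₁) for some s₁ ∈ [0,1], then κ and τ can be chosen with κ = 1. -/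
open MeasureTheory Set Filter

noncomputable section

section core
variable {Ω : Type*} [MeasurableSpace Ω]

/-- truncated integral -/
def Dint (ν : Measure Ω) (P Q g : Ω → ℝ) (s : ℝ) : ℝ :=
  ∫ y, (if (1 - s) * Q y ≤ s * P y then g y else 0) ∂ν

theorem Dint_int (ν : Measure Ω) (P Q g : Ω → ℝ) (hP : Measurable P) (hQ : Measurable Q)
    (hg : Integrable g ν) (s : ℝ) :
    Integrable (fun y => if (1 - s) * Q y ≤ s * P y then g y else 0) ν := by
  have hm : MeasurableSet {y | (1 - s) * Q y ≤ s * P y} :=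
    measurableSet_le (hQ.const_mul _) (hP.const_mul _)
  have := hg.indicator hm
  refine this.congr (Eventually.of_forall fun y => ?_)
  simp [Set.indicator]

theorem Dint_cont (ν : Measure Ω) (P Q g : Ω → ℝ) (hP : Measurable P) (hQ : Measurable Q)
    (hg : Integrable g ν) (s : ℝ) (hn : ∀ᵐ y ∂ν, s * P y ≠ (1 - s) * Q y) :
    ContinuousAt (Dint ν P Q g) s := by
  unfold Dint
  apply continuousAt_of_dominated (bound := fun y => ‖g y‖)
  · exact Eventually.of_forall fun t => (Dint_int ν P Q g hP hQ hg t).aestronglyMeasurable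
  · refine Eventually.of_forall fun t => Eventually.of_forall fun y => ?_
    split_ifs <;> simp
  · exact hg.norm
  · filter_upwards [hn] with y hy
    have c1 : ContinuousAt (fun t : ℝ => t * P y - (1 - t) * Q y) s := by fun_prop
    rcases lt_or_gt_of_ne hy with h | h
    · have : ∀ᶠ t in nhds s, t * P y - (1 - t) * Q y < 0 :=
        c1.eventually_lt continuousAt_const (by linarith)
      have e : (fun t : ℝ => if (1 - t) * Q y ≤ t * P y then g y else 0) =ᶠ[nhds s] fun _ => 0 := by
        filter_upwards [this] with t ht
        rw [if_neg]; linarith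
      exact continuousAt_const.congr e.symm
    · have : ∀ᶠ t in nhds s, 0 < t * P y - (1 - t) * Q y :=
        continuousAt_const.eventually_lt c1 (by linarith)
      have e : (fun t : ℝ => if (1 - t) * Q y ≤ t * P y then g y else 0) =ᶠ[nhds s] fun _ => g y := by
        filter_upwards [this] with t ht
        rw [if_pos]; linarith
      exact continuousAt_const.congr e.symm

theorem core (ν : Measure Ω) (P Q F : Ω → ℝ) (hP : Measurable P) (hQ : Measurable Q)
    (hP0 : ∀ᵐ y ∂ν, 0 ≤ P y) (hQ0 : ∀ᵐ y ∂ν, 0 ≤ Q y) (hF : ∀ y, 0 ≤ F y)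
    (hip : Integrable (fun y => P y * F y) ν) (hiq : Integrable (fun y => Q y * F y) ν)
    (hn : ∀ s ∈ Icc (0:ℝ) 1, ∀ᵐ y ∂ν, s * P y ≠ (1 - s) * Q y)
    (C : ℝ) (hC : 0 < C) (h1p : C * ∫ y, P y * F y ∂ν = 1) (h1q : C * ∫ y, Q y * F y ∂ν = 1)
    (U : ℝ → ℝ)
    (hU : ∀ s, U s = C * ∫ y, max (s * (P y * F y) - (1 - s) * (Q y * F y)) 0 ∂ν)
    (a b : ℝ) (hb : 0 ≤ b)
    (hbelow : ∀ s ∈ Set.Icc (0:ℝ) 1, a * s - b ≤ U s)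
    (habove : ∃ s₀ ∈ Set.Icc (0:ℝ) 1, max 0 (2 * s₀ - 1) < a * s₀ - b) :
    ∃ κ ∈ Icc (0:ℝ) 1, ∃ s ∈ Ioc (0:ℝ) 1,
      C * κ * Dint ν P Q (fun y => P y * F y) s = a - b ∧
      C * κ * Dint ν P Q (fun y => Q y * F y) s = b ∧
      ((∃ s₁ ∈ Set.Icc (0:ℝ) 1, a * s₁ - b = U s₁) → κ = 1) := by
  set A : ℝ → ℝ := fun s => C * Dint ν P Q (fun y => P y * F y) s with hA
  set B : ℝ → ℝ := fun s => C * Dint ν P Q (fun y => Q y * F y) s with hB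
  have iA := fun s => Dint_int ν P Q _ hP hQ hip s
  have iB := fun s => Dint_int ν P Q _ hP hQ hiq s
  have cA : ContinuousOn A (Icc 0 1) := fun s hs =>
    (continuousAt_const.mul (Dint_cont ν P Q _ hP hQ hip s (hn s hs))).continuousWithinAt
  have cB : ContinuousOn B (Icc 0 1) := fun s hs =>
    (continuousAt_const.mul (Dint_cont ν P Q _ hP hQ hiq s (hn s hs))).continuousWithinAt
  have imax : ∀ s : ℝ, Integrable (fun y => max (s * (P y * F y) - (1 - s) * (Q y * F y)) 0) ν :=
    fun s => ((hip.const_mul s).sub (hiq.const_mul (1-s))).pos_part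
  have comb : ∀ s t : ℝ, s * A t - (1 - s) * B t =
      C * ∫ y, (s * (if (1 - t) * Q y ≤ t * P y then P y * F y else 0)
        - (1 - s) * (if (1 - t) * Q y ≤ t * P y then Q y * F y else 0)) ∂ν := by
    intro s t
    rw [integral_sub ((iA t).const_mul s) ((iB t).const_mul (1-s)), integral_const_mul,
      integral_const_mul]
    simp only [hA, hB, Dint]; ring
  have F2 : ∀ s, U s = s * A s - (1 - s) * B s := by
    intro s
    rw [hU, comb]
    congr 2; ext y
    have e : s * (P y * F y) - (1 - s) * (Q y * F y) = (s * P y - (1-s) * Q y) * F y := by ring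
    split_ifs with h
    · rw [max_eq_left]
      rw [e]; exact mul_nonneg (by linarith) (hF y)
    · rw [max_eq_right]
      · ring
      · rw [e]; exact mul_nonpos_of_nonpos_of_nonneg (by linarith) (hF y)
  have F3 : ∀ s t, s * A t - (1 - s) * B t ≤ U s := by
    intro s t
    rw [hU, comb]
    refine mul_le_mul_of_nonneg_left (integral_mono (((iA t).const_mul s).sub ((iB t).const_mul (1-s))) (imax s) ?_) hC.le
    intro y
    dsimp only
    split_ifs with h
    · exact le_max_left _ _
    · simp
  have F4 : ∀ s t, 0 ≤ s → s ≤ t → t ≤ 1 → A s ≤ A t := by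
    intro s t hs hst ht
    refine mul_le_mul_of_nonneg_left (integral_mono_ae (iA s) (iA t) ?_) hC.le
    filter_upwards [hP0, hQ0] with y hp hq
    split_ifs with h h' h'
    · exact le_rfl
    · exfalso; apply h'; nlinarith
    · exact mul_nonneg hp (hF y)
    · exact le_rfl
  have A0 : A 0 = 0 := by
    have : Dint ν P Q (fun y => P y * F y) 0 = 0 := by
      unfold Dint
      rw [integral_eq_zero_of_ae]
      filter_upwards [hQ0, hn 0 (by simp)] with y hq h
      rw [if_neg]; · rfl
      intro h'
      apply h; linarith
    simp [hA, this]
  have one : ∀ g : Ω → ℝ, Dint ν P Q g 1 = ∫ y, g y ∂ν := by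
    intro g
    unfold Dint
    apply integral_congr_ae
    filter_upwards [hP0] with y hp
    rw [if_pos]; linarith
  have A1 : A 1 = 1 := by simp only [hA, one, h1p]
  have B1 : B 1 = 1 := by simp only [hB, one, h1q]
  have B0 : ∀ s, 0 ≤ B s := by
    intro s
    refine mul_nonneg hC.le (integral_nonneg_of_ae ?_)
    filter_upwards [hQ0] with y hq
    simp only [Pi.zero_apply]
    split_ifs
    · exact mul_nonneg hq (hF y)
    · exact le_rfl
  obtain ⟨α, hα⟩ : ∃ α, α = a - b := ⟨_, rfl⟩
  have ha : a = α + b := by linarith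
  subst ha
  have hα1 : α ≤ 1 := by
    have := hbelow 1 (by simp)
    rw [F2, A1] at this; linarith
  obtain ⟨s₀, ⟨hs0, hs0'⟩, h0⟩ := habove
  have h01 := (le_max_left _ _).trans_lt h0
  have h02 := (le_max_right _ _).trans_lt h0
  have hαpos : 0 < α := by
    by_contra! h
    nlinarith
  have hβα : b < α := by
    by_contra! h
    nlinarith
  -- IVT for A
  obtain ⟨σ, hσ, hAσ⟩ : α ∈ A '' Icc 0 1 :=
    intermediate_value_Icc zero_le_one cA ⟨by rw [A0]; exact hαpos.le, by rw [A1]; exact hα1⟩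
  have hBσ : B σ ≤ b := by
    rcases eq_or_lt_of_le hσ.2 with h | h
    · subst h
      have hα' : α = 1 := by rw [← hAσ, A1]
      have key : ∀ s ∈ Ico (0:ℝ) 1, B s ≤ b := by
        intro s hs
        have := hbelow s ⟨hs.1, hs.2.le⟩
        rw [F2] at this
        have hm := F4 s 1 hs.1 hs.2.le le_rfl
        rw [A1] at hm
        have : (1 - s) * B s ≤ (1 - s) * b := by nlinarith [hs.1]
        exact le_of_mul_le_mul_left this (by linarith [hs.2])
      have t : Tendsto B (nhdsWithin 1 (Ico 0 1)) (nhds (B 1)) :=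
        (cB 1 (by simp)).mono_left (nhdsWithin_mono _ Ico_subset_Icc_self)
      have : (nhdsWithin (1:ℝ) (Ico 0 1)).NeBot := by
        rw [← mem_closure_iff_nhdsWithin_neBot, closure_Ico zero_ne_one]; simp
      exact le_of_tendsto t (eventually_mem_nhdsWithin.mono key)
    · have := hbelow σ hσ
      rw [F2, hAσ] at this
      have : (1 - σ) * B σ ≤ (1 - σ) * b := by linarith
      exact le_of_mul_le_mul_left this (by linarith)
  have sub : Icc σ 1 ⊆ Icc (0:ℝ) 1 := Icc_subset_Icc_left hσ.1
  obtain ⟨s, hs, hhs⟩ : (0:ℝ) ∈ (fun s => α * B s - b * A s) '' Icc σ 1 := by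
    refine intermediate_value_Icc hσ.2
      ((continuousOn_const.mul (cB.mono sub)).sub (continuousOn_const.mul (cA.mono sub))) ⟨?_, ?_⟩
    · change α * B σ - b * A σ ≤ 0
      rw [hAσ]; nlinarith
    · change 0 ≤ α * B 1 - b * A 1
      rw [A1, B1]; linarith
  dsimp only at hhs
  have hAs : α ≤ A s := by rw [← hAσ]; exact F4 σ s hσ.1 hs.1 hs.2
  have hAs0 : 0 < A s := hαpos.trans_le hAs
  have hs0 : 0 < s := by
    rcases eq_or_lt_of_le (sub hs).1 with h | h
    · rw [← h, A0] at hAs0; exact absurd hAs0 (lt_irrefl _)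
    · exact h
  have e1 : α / A s * A s = α := by field_simp
  have e2 : α / A s * B s = b := by field_simp; linarith
  refine ⟨α / A s, ⟨by positivity, (div_le_one hAs0).2 hAs⟩, s, ⟨hs0, hs.2⟩, ?_, ?_, ?_⟩
  · rw [show α + b - b = α by ring]
    refine Eq.trans ?_ e1
    simp only [hA]; ring
  · refine Eq.trans ?_ e2
    simp only [hB]; ring
  · rintro ⟨s₁, hs₁, h⟩
    set κ := α / A s with hκ
    have hκ1 : κ ≤ 1 := (div_le_one hAs0).2 hAs
    have hκ0 : 0 < κ := by positivity
    have e3 : U s₁ = κ * (s₁ * A s - (1 - s₁) * B s) := by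
      rw [← h]; linear_combination -s₁ * e1 + (1 - s₁) * e2
    have le := F3 s₁ s
    by_cases hU0 : 0 < U s₁
    · apply le_antisymm hκ1
      by_contra! hlt
      nlinarith
    · exfalso
      have hUn : 0 ≤ U s₁ := by
        rw [hU]
        exact mul_nonneg hC.le (integral_nonneg fun y => le_max_right _ _)
      have hUz : U s₁ = 0 := le_antisymm (not_lt.1 hU0) hUn
      have z : s₁ * A s - (1 - s₁) * B s = 0 := by
        rw [hUz] at e3
        rcases mul_eq_zero.1 e3.symm with h | h
        · exact absurd h hκ0.ne'
        · exact h
      rw [comb] at z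
      rw [hU] at hUz
      have z1 := (mul_eq_zero.1 z).resolve_left hC.ne'
      have z2 := (mul_eq_zero.1 hUz).resolve_left hC.ne'
      have y2 := (integral_eq_zero_iff_of_nonneg (fun y => le_max_right _ _) (imax s₁)).1 z2
      have i1 : Integrable (fun y => -(s₁ * (if (1 - s) * Q y ≤ s * P y then P y * F y else 0)
        - (1 - s₁) * (if (1 - s) * Q y ≤ s * P y then Q y * F y else 0))) ν :=
        (((iA s).const_mul s₁).sub ((iB s).const_mul (1-s₁))).neg
      have y1 : (fun y => -(s₁ * (if (1 - s) * Q y ≤ s * P y then P y * F y else 0)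
        - (1 - s₁) * (if (1 - s) * Q y ≤ s * P y then Q y * F y else 0))) =ᵐ[ν] 0 := by
        refine (integral_eq_zero_iff_of_nonneg_ae ?_ i1).1 ?_
        · filter_upwards [y2] with y hy
          dsimp only [Pi.zero_apply] at hy ⊢
          have := le_max_left (s₁ * (P y * F y) - (1 - s₁) * (Q y * F y)) 0
          split_ifs
          · linarith
          · simp
        · rw [integral_neg, z1, neg_zero]
      have : A s = 0 := by
        have : Dint ν P Q (fun y => P y * F y) s = 0 := by
          unfold Dint
          rw [integral_eq_zero_of_ae]
          filter_upwards [y1, hn s₁ hs₁] with y hy hne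
          dsimp only [Pi.zero_apply] at hy ⊢
          split_ifs with hc
          · rw [if_pos hc, if_pos hc] at hy
            have : (s₁ * P y - (1 - s₁) * Q y) * F y = 0 := by linarith
            rcases mul_eq_zero.1 this with h | h
            · exact absurd (by linarith) hne
            · rw [h, mul_zero]
          · rfl
        simp [hA, this]
      exact hAs0.ne' this

end core

theorem cube_restrict_ae (m : ℕ) :
    ∀ᵐ y ∂(volume.restrict (cube m)), ∀ i, y i ∈ Ioo (0:ℝ) 1 := by
  have h : (univ.pi fun _ : Fin m => Ioo (0:ℝ) 1) =ᵐ[volume] cube m := by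
    have := Measure.univ_pi_Ioo_ae_eq_Icc (μ := fun _ : Fin m => (volume : Measure ℝ))
      (f := fun _ => 0) (g := fun _ => 1)
    rw [← Set.pi_univ_Icc] at this
    exact this
  rw [← Measure.restrict_congr_set h]
  filter_upwards [ae_restrict_mem (MeasurableSet.univ_pi fun _ => measurableSet_Ioo)] with y hy i
  exact hy i (mem_univ i)

theorem null_level (k : ℕ) (s : ℝ) (hs : s ∈ Icc (0:ℝ) 1) :
    ∀ᵐ y ∂(volume.restrict (cube (k+1))), s * ∏ i, y i ≠ (1 - s) * ∏ i, (1 - y i) := by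
  set E : Set (ℝ × (Fin k → ℝ)) := {z | (∀ i, z.2 i ∈ Ioo (0:ℝ) 1) ∧
    s * (z.1 * ∏ i, z.2 i) = (1 - s) * ((1 - z.1) * ∏ i, (1 - z.2 i))} with hE
  have mE : MeasurableSet E := by
    apply MeasurableSet.inter
    · have : {z : ℝ × (Fin k → ℝ) | ∀ i, z.2 i ∈ Ioo (0:ℝ) 1} =
        ⋂ i, {z : ℝ × (Fin k → ℝ) | z.2 i ∈ Ioo (0:ℝ) 1} := by ext; simp
      change MeasurableSet {z : ℝ × (Fin k → ℝ) | ∀ i, z.2 i ∈ Ioo (0:ℝ) 1}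
      rw [this]
      refine MeasurableSet.iInter fun i => ?_
      have : Measurable fun z : ℝ × (Fin k → ℝ) => z.2 i := by fun_prop
      exact this measurableSet_Ioo
    · refine measurableSet_eq_fun ?_ ?_ <;> fun_prop
  have nE : volume E = 0 := by
    rw [Measure.volume_eq_prod, Measure.prod_apply_symm mE]
    rw [lintegral_eq_zero_of_ae_eq_zero]
    refine Eventually.of_forall fun y => ?_
    refine Set.Subsingleton.measure_zero ?_ _
    rintro u ⟨hu, hu'⟩ v ⟨_, hv'⟩
    dsimp only at hu hu' hv'
    have p1 : 0 < ∏ i, y i := Finset.prod_pos fun i _ => (hu i).1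
    have p2 : 0 < ∏ i, (1 - y i) := Finset.prod_pos fun i _ => by linarith [(hu i).2]
    have pos : 0 < s * ∏ i, y i + (1 - s) * ∏ i, (1 - y i) := by
      rcases eq_or_lt_of_le hs.1 with h | h
      · rw [← h]; simpa using p2
      · have := mul_pos h p1
        have := mul_nonneg (sub_nonneg.2 hs.2) p2.le
        linarith
    have : (u - v) * (s * ∏ i, y i + (1 - s) * ∏ i, (1 - y i)) = 0 := by
      linear_combination hu' - hv'
    rcases mul_eq_zero.1 this with h | h
    · linarith
    · exact absurd h pos.ne'
  have mp := volume_preserving_piFinSuccAbove (fun _ : Fin (k+1) => ℝ) 0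
  have := mp.quasiMeasurePreserving.ae (measure_eq_zero_iff_ae_notMem.1 nE)
  filter_upwards [cube_restrict_ae (k+1), ae_restrict_of_ae this] with y hy hy' h
  apply hy'
  refine ⟨fun i => hy _, ?_⟩
  rw [Fin.prod_univ_succ, Fin.prod_univ_succ] at h
  exact h

theorem marg_int {f f' : ℝ → ℝ} {L R : ℝ} (hL : 0 ≤ L) (hLR : L < R) (hR : R ≤ 1)
    (hf : Density f f' L R) (g : ℝ → ℝ) (hg : Continuous g) :
    Integrable (fun s => g s * f s) (volume.restrict (Icc 0 1)) ∧
    ∫ s in Icc (0:ℝ) 1, g s * f s = ∫ s in L..R, g s * f s := by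
  have hz : ∀ s, s ∉ Icc L R → g s * f s = 0 := fun s hs => by rw [hf.zero_outside s hs, mul_zero]
  have hc : ContinuousOn (fun s => g s * f s) (Icc L R) :=
    hg.continuousOn.mul fun s hs => (hf.hderiv s hs).continuousWithinAt
  have hi : IntegrableOn (fun s => g s * f s) (Icc L R) := hc.integrableOn_Icc
  have hi' : Integrable (fun s => g s * f s) := by
    rw [← integrableOn_iff_integrable_of_support_subset (s := Icc L R)]
    · exact hi
    · intro s hs
      by_contra h
      exact hs (hz s h)
  refine ⟨hi'.integrableOn, ?_⟩
  rw [intervalIntegral.integral_of_le hLR.le, ← integral_Icc_eq_integral_Ioc]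
  exact setIntegral_eq_of_subset_of_forall_diff_eq_zero measurableSet_Icc
    (Icc_subset_Icc hL hR) (fun s hs => hz s hs.2)

theorem prod_int {f f' : ℝ → ℝ} {L R : ℝ} (hL : 0 ≤ L) (hLR : L < R) (hR : R ≤ 1)
    (hf : Density f f' L R) (g : ℝ → ℝ) (hg : Continuous g) (m : ℕ)
    (hh : (∫ s in L..R, g s * f s) = 1 / 2) :
    Integrable (fun y : Fin m → ℝ => ∏ k, g (y k) * f (y k)) (volume.restrict (cube m)) ∧
    (2:ℝ) ^ m * ∫ y in cube m, ∏ k, g (y k) * f (y k) = 1 := by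
  obtain ⟨h1, h2⟩ := marg_int hL hLR hR hf g hg
  have e : (volume : Measure (Fin m → ℝ)).restrict (cube m) =
      Measure.pi fun _ => (volume : Measure ℝ).restrict (Icc 0 1) :=
    Measure.restrict_pi_pi _ _
  rw [e]
  refine ⟨Integrable.fintype_prod (f := fun _ s => g s * f s) fun _ => h1, ?_⟩
  rw [integral_fintype_prod_eq_prod (fun _ s => g s * f s), h2, hh]
  simp [← mul_pow]

theorem stmt10 (n : ℕ) (hn : 2 ≤ n) (L R : ℝ) (hL : 0 ≤ L) (hLR : L < R) (hR : R ≤ 1)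
    (f f' : ℝ → ℝ) (hf : Density f f' L R)
    (a b : ℝ) (ha : a ∈ Set.Icc (0:ℝ) 2) (hb : 0 ≤ b)
    (hbelow : ∀ s ∈ Set.Icc (0:ℝ) 1, a * s - b ≤ Ubar f (n - 1) s)
    (habove : ∃ s₀ ∈ Set.Icc (0:ℝ) 1, max 0 (2 * s₀ - 1) < a * s₀ - b) :
    (∃ κ ∈ Set.Icc (0:ℝ) 1, ∃ τ : ℝ, 0 ≤ τ ∧
      (2:ℝ) ^ (n - 1) * κ *
        (∫ y in cube (n - 1),
          (if τ * ∏ k, (1 - y k) ≤ ∏ k, y k then wplus f y + wminus f y else 0)) = a ∧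
      (2:ℝ) ^ (n - 1) * κ *
        (∫ y in cube (n - 1),
          (if τ * ∏ k, (1 - y k) ≤ ∏ k, y k then wminus f y else 0)) = b) ∧
    ((∃ s₁ ∈ Set.Icc (0:ℝ) 1, a * s₁ - b = Ubar f (n - 1) s₁) →
      ∃ τ : ℝ, 0 ≤ τ ∧
        (2:ℝ) ^ (n - 1) * (1:ℝ) *
          (∫ y in cube (n - 1),
            (if τ * ∏ k, (1 - y k) ≤ ∏ k, y k then wplus f y + wminus f y else 0)) = a ∧
        (2:ℝ) ^ (n - 1) * (1:ℝ) *
          (∫ y in cube (n - 1),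
            (if τ * ∏ k, (1 - y k) ≤ ∏ k, y k then wminus f y else 0)) = b) := by
  obtain ⟨k, rfl⟩ : ∃ k, n = k + 1 + 1 := ⟨n - 2, by omega⟩
  simp only [Nat.add_sub_cancel] at *
  have hfc := hf.hderiv
  have mean' : (∫ s in L..R, (1 - s) * f s) = 1 / 2 := by
    have hc : ContinuousOn f (uIcc L R) := by
      rw [uIcc_of_le hLR.le]
      exact fun s hs => (hfc s hs).continuousWithinAt
    have i1 : IntervalIntegrable f volume L R := hc.intervalIntegrable
    have i2 : IntervalIntegrable (fun s => s * f s) volume L R :=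
      (continuousOn_id.mul hc).intervalIntegrable
    have : (fun s => (1 - s) * f s) = fun s => f s - s * f s := by ext; ring
    rw [this, intervalIntegral.integral_sub i1 i2, hf.total, hf.mean]; norm_num
  obtain ⟨ip, tp⟩ := prod_int hL hLR hR hf (fun s => s) continuous_id (k+1) hf.mean
  obtain ⟨iq, tq⟩ := prod_int hL hLR hR hf (fun s => 1 - s) (by fun_prop) (k+1) mean'
  have ep : ∀ y : Fin (k+1) → ℝ, wplus f y = (∏ i, y i) * ∏ i, f (y i) := fun y =>
    Finset.prod_mul_distrib
  have eq : ∀ y : Fin (k+1) → ℝ, wminus f y = (∏ i, (1 - y i)) * ∏ i, f (y i) := fun y =>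
    Finset.prod_mul_distrib
  have hae := cube_restrict_ae (k+1)
  have ipp : Integrable (fun y : Fin (k+1) → ℝ => (∏ i, y i) * ∏ i, f (y i))
      (volume.restrict (cube (k+1))) := by simpa only [Finset.prod_mul_distrib] using ip
  have iqq : Integrable (fun y : Fin (k+1) → ℝ => (∏ i, (1 - y i)) * ∏ i, f (y i))
      (volume.restrict (cube (k+1))) := by simpa only [Finset.prod_mul_distrib] using iq
  obtain ⟨κ, hκ, s, hs, h1, h2, h3⟩ := core (volume.restrict (cube (k+1)))
    (fun y => ∏ i, y i) (fun y => ∏ i, (1 - y i)) (fun y => ∏ i, f (y i))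
    (by fun_prop) (by fun_prop)
    (by filter_upwards [hae] with y hy
        exact Finset.prod_nonneg fun i _ => (hy i).1.le)
    (by filter_upwards [hae] with y hy
        exact Finset.prod_nonneg fun i _ => by linarith [(hy i).2])
    (fun y => Finset.prod_nonneg fun i _ => hf.nonneg _)
    ipp iqq (fun s hs => null_level k s hs) (2 ^ (k+1)) (by positivity)
    (by simpa only [Finset.prod_mul_distrib] using tp)
    (by simpa only [Finset.prod_mul_distrib] using tq)
    (Ubar f (k+1)) (fun s => by simp only [Ubar, ep, eq]) a b hb hbelow habove
  have iA := Dint_int (volume.restrict (cube (k+1)))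
    (fun y => ∏ i, y i) (fun y => ∏ i, (1 - y i)) _ (by fun_prop) (by fun_prop) ipp s
  have iB := Dint_int (volume.restrict (cube (k+1)))
    (fun y => ∏ i, y i) (fun y => ∏ i, (1 - y i)) _ (by fun_prop) (by fun_prop) iqq s
  have hτ : ∀ y : Fin (k+1) → ℝ, ((1 - s) / s * ∏ i, (1 - y i) ≤ ∏ i, y i) ↔
      ((1 - s) * ∏ i, (1 - y i) ≤ s * ∏ i, y i) := fun y => by
    rw [div_mul_eq_mul_div, div_le_iff₀ hs.1, mul_comm (∏ i, y i) s]
  have hτ0 : 0 ≤ (1 - s) / s := div_nonneg (by linarith [hs.2]) hs.1.le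
  have c2 : (2:ℝ) ^ (k+1) * κ * (∫ y in cube (k+1),
      (if (1 - s) / s * ∏ k, (1 - y k) ≤ ∏ k, y k then wminus f y else 0)) = b := by
    simp only [hτ, eq]; exact h2
  have c1 : (2:ℝ) ^ (k+1) * κ * (∫ y in cube (k+1),
      (if (1 - s) / s * ∏ k, (1 - y k) ≤ ∏ k, y k then wplus f y + wminus f y else 0)) = a := by
    simp only [hτ, eq, ep]
    have e : (∫ y in cube (k+1), (if (1 - s) * ∏ i, (1 - y i) ≤ s * ∏ i, y i then
        (∏ i, y i) * ∏ i, f (y i) + (∏ i, (1 - y i)) * ∏ i, f (y i) else 0)) = _ :=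
      Eq.trans (integral_congr_ae (Eventually.of_forall fun y => by
        dsimp only; split_ifs <;> simp)) (integral_add iA iB)
    rw [e, mul_add]
    unfold Dint at h1 h2
    rw [h1, h2]; ring
  refine ⟨⟨κ, hκ, _, hτ0, c1, c2⟩, fun h => ⟨_, hτ0, ?_, ?_⟩⟩
  · rw [h3 h] at c1; exact c1
  · rw [h3 h] at c2; exact c2
end
end
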